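/- Let L be a stably continuous lattice, C a bicomplete regular category in which directed colimits commute with finite limits, and A an object of C. Let M be the (large) sub-preorder of [σFilt(L), RegEpi(A)] consisting of those monotone maps that preserve finite infima and arbitrary suprema and whose images consist of pairwise ker-commuting regular epimorphisms. Then there is an equivalence of categories M ≃ sΩShr_A(L, C) between M and the category of soft Ω-sheaf representations of A over L. -/

import Mathlib

open CategoryTheory CategoryTheory.Limits Opposite

universe w v u

class RegularCat (C : Type u) [Category.{v} C] [HasFiniteLimits C] : Prop where
  factor : ∀ {X Y : C} (f : X ⟶ Y), ∃ (Z : C) (e : X ⟶ Z) (m : Z ⟶ Y),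
      Nonempty (RegularEpi e) ∧ Mono m ∧ e ≫ m = f
  stable : ∀ {X Y Z : C} (f : X ⟶ Y) (g : Z ⟶ Y),
      Nonempty (RegularEpi f) → Nonempty (RegularEpi (pullback.snd f g))

variable {C : Type u} [Category.{v} C]

structure RegEpiOver (A : C) : Type (max u v) where
  cod : C
  hom : A ⟶ cod
  regEpi : Nonempty (RegularEpi hom)

/-- f ≤ g in RegEpi(A) iff g = h ∘ f for some h. -/
def RegEpiOver.le {A : C} (f g : RegEpiOver A) : Prop :=
  ∃ h : f.cod ⟶ g.cod, f.hom ≫ h = g.hom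

variable [HasFiniteLimits C]

/-- The kernel pair of f, as a map into A ⨯ A. -/
noncomputable def kerPairMap {A B : C} (f : A ⟶ B) : pullback f f ⟶ A ⨯ A :=
  prod.lift (pullback.fst f f) (pullback.snd f f)

/-- The object U in the construction of the composite of two relations r : R ↣ A × A and
s : S ↣ A × A: the equaliser of the two maps R ⨯ S ⟶ A given by the second leg of r and
the first leg of s. -/
noncomputable def relCompDom {A R S : C} (r : R ⟶ A ⨯ A) (s : S ⟶ A ⨯ A) : C :=
  equalizer ((prod.fst : R ⨯ S ⟶ R) ≫ r ≫ (prod.snd : A ⨯ A ⟶ A))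
    ((prod.snd : R ⨯ S ⟶ S) ≫ s ≫ (prod.fst : A ⨯ A ⟶ A))

/-- The canonical map U ⟶ A ⨯ A whose image is the composite relation r ∘ s. -/
noncomputable def relCompMap {A R S : C} (r : R ⟶ A ⨯ A) (s : S ⟶ A ⨯ A) :
    relCompDom r s ⟶ A ⨯ A :=
  equalizer.ι _ _ ≫
    prod.lift ((prod.fst : R ⨯ S ⟶ R) ≫ r ≫ (prod.fst : A ⨯ A ⟶ A))
      ((prod.snd : R ⨯ S ⟶ S) ≫ s ≫ (prod.snd : A ⨯ A ⟶ A))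

/-- t : T ⟶ A ⨯ A is (an image factorisation of) the composite relation of r and s. -/
def IsRelComp {A R S T : C} (r : R ⟶ A ⨯ A) (s : S ⟶ A ⨯ A) (t : T ⟶ A ⨯ A) : Prop :=
  ∃ e : relCompDom r s ⟶ T, Nonempty (RegularEpi e) ∧ e ≫ t = relCompMap r s

/-- Two monomorphisms into X determine the same subobject. -/
def SameSub {X T W : C} (t : T ⟶ X) (w : W ⟶ X) : Prop :=
  (∃ u : T ⟶ W, u ≫ w = t) ∧ (∃ v : W ⟶ T, v ≫ t = w)

/-- A relation t on A is effective if it is, as a subobject of A ⨯ A, the kernel pair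
of some morphism. -/
def IsEffective {A T : C} (t : T ⟶ A ⨯ A) : Prop :=
  ∃ (B : C) (h : A ⟶ B), SameSub t (kerPairMap h)

/-- Two regular epimorphisms with domain A ker-commute: the composites
ker f ∘ ker g and ker g ∘ ker f coincide (as subobjects of A ⨯ A) and this composite
is an effective equivalence relation. -/
def KerCommute {A : C} (f g : RegEpiOver A) : Prop :=
  ∃ (T : C) (t : T ⟶ A ⨯ A), Mono t ∧
    IsRelComp (kerPairMap f.hom) (kerPairMap g.hom) t ∧
    IsRelComp (kerPairMap g.hom) (kerPairMap f.hom) t ∧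
    IsEffective t

section OrderTheory

variable {L : Type w} [PartialOrder L]

/-- x is way below y: for every directed subset D admitting a supremum,
y ≤ sup D implies x ≤ d for some d ∈ D. -/
def WayBelow (x y : L) : Prop :=
  ∀ D : Set L, D.Nonempty → DirectedOn (· ≤ ·) D → ∀ s, IsLUB D s → y ≤ s → ∃ d ∈ D, x ≤ d

/-- ↡x = {y | y ≪ x}. -/
def wb (x : L) : Set L := {y | WayBelow y x}

variable (L) in
/-- A dcpo: every (nonempty) directed subset has a supremum. -/
def IsDcpo : Prop :=
  ∀ D : Set L, D.Nonempty → DirectedOn (· ≤ ·) D → ∃ s, IsLUB D s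

variable (L) in
/-- A domain: a dcpo in which every ↡x is directed with supremum x. -/
def IsDomainL : Prop :=
  IsDcpo L ∧ ∀ x : L, (wb x).Nonempty ∧ DirectedOn (· ≤ ·) (wb x) ∧ IsLUB (wb x) x

/-- A filter on L: a nonempty, upward-closed, codirected subset. -/
def IsFilterSet (k : Set L) : Prop :=
  k.Nonempty ∧ (∀ x ∈ k, ∀ y, x ≤ y → y ∈ k) ∧ DirectedOn (· ≥ ·) k

/-- A Scott-open filter on L. -/
def IsScottOpenFilter (k : Set L) : Prop :=
  IsFilterSet k ∧
  ∀ D : Set L, D.Nonempty → DirectedOn (· ≤ ·) D → ∀ s, IsLUB D s → s ∈ k → (D ∩ k).Nonempty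

variable (L) in
/-- σFilt(L): the poset of Scott-open filters on L, ordered by inclusion. -/
def SFilt : Type w := {k : Set L // IsScottOpenFilter k}

instance : PartialOrder (SFilt L) :=
  inferInstanceAs (PartialOrder {k : Set L // IsScottOpenFilter k})

end OrderTheory

section Functors

variable {J : Type w} [PartialOrder J]

/-- The elementwise statement that the cone (F(s) → F(d))_{d ∈ D} is a limit of the
restriction of the presheaf F to D. -/
def IsLimitOn (F : Jᵒᵖ ⥤ C) (D : Set J) (s : J) : Prop :=
  ∀ (B : C) (c : ∀ d ∈ D, B ⟶ F.obj (op d)),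
    (∀ d e (hd : d ∈ D) (he : e ∈ D) (h : d ≤ e), c e he ≫ F.map (homOfLE h).op = c d hd) →
    ∃! u : B ⟶ F.obj (op s), ∀ d (hd : d ∈ D) (hds : d ≤ s),
      u ≫ F.map (homOfLE hds).op = c d hd

end Functors

section OmegaSheaves

variable {L : Type w} [CompleteLattice L]

/-- A C-valued Ω-sheaf on the complete lattice L. -/
def IsOmegaSheaf (F : Lᵒᵖ ⥤ C) : Prop :=
  Mono (terminal.from (F.obj (op (⊥ : L)))) ∧
  (∀ x y : L, IsPullback (F.map (homOfLE (le_sup_left : x ≤ x ⊔ y)).op)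
    (F.map (homOfLE (le_sup_right : y ≤ x ⊔ y)).op)
    (F.map (homOfLE (inf_le_left : x ⊓ y ≤ x)).op)
    (F.map (homOfLE (inf_le_right : x ⊓ y ≤ y)).op)) ∧
  (∀ D : Set L, D.Nonempty → DirectedOn (· ≤ ·) D → IsLimitOn F D (sSup D))

/-- An Ω-sheaf F on L is soft if, for every Scott-open filter k on L, the canonical
map F(⊤) → colim_{x ∈ k} F(x) is a regular epimorphism: for every colimit cocone
(legs into Q) of the restriction of F to k, the composite of any restriction map
F(⊤) → F(x) (x ∈ k) with the corresponding leg is a regular epimorphism. -/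
def IsSoftOmega (F : Lᵒᵖ ⥤ C) : Prop :=
  ∀ k : Set L, IsScottOpenFilter k →
    ∀ (Q : C) (legs : ∀ x ∈ k, F.obj (op x) ⟶ Q),
      (∀ x y (hx : x ∈ k) (hy : y ∈ k) (h : x ≤ y),
        F.map (homOfLE h).op ≫ legs x hx = legs y hy) →
      (∀ (B : C) (c : ∀ x ∈ k, F.obj (op x) ⟶ B),
        (∀ x y (hx : x ∈ k) (hy : y ∈ k) (h : x ≤ y),
          F.map (homOfLE h).op ≫ c x hx = c y hy) →
        ∃! u : Q ⟶ B, ∀ x (hx : x ∈ k), legs x hx ≫ u = c x hx) →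
      ∀ x (hx : x ∈ k) (hle : x ≤ ⊤),
        Nonempty (RegularEpi (F.map (homOfLE hle).op ≫ legs x hx))

variable (C) in
/-- A soft Ω-sheaf representation of A over L. -/
structure SoftOmShrRep (A : C) : Type (max u v w) where
  F : Lᵒᵖ ⥤ C
  osheaf : IsOmegaSheaf F
  soft : IsSoftOmega F
  φ : A ⟶ F.obj (op (⊤ : L))
  iso : IsIso φ

instance {A : C} : Category (SoftOmShrRep C (L := L) A) where
  Hom X Y := {α : X.F ⟶ Y.F // X.φ ≫ α.app (op (⊤ : L)) = Y.φ}
  id X := ⟨𝟙 X.F, by simp⟩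
  comp f g := ⟨f.1 ≫ g.1, by rw [NatTrans.comp_app, ← Category.assoc, f.2, g.2]⟩
  id_comp f := Subtype.ext (by simp)
  comp_id f := Subtype.ext (by simp)
  assoc f g h := Subtype.ext (by simp)

end OmegaSheaves

section Msig

variable {L : Type w} [PartialOrder L]

theorem RegEpiOver.le_refl' {A : C} (f : RegEpiOver A) : f.le f :=
  ⟨𝟙 _, Category.comp_id _⟩

theorem RegEpiOver.le_trans' {A : C} {f g h : RegEpiOver A} :
    f.le g → g.le h → f.le h := by
  rintro ⟨a, ha⟩ ⟨b, hb⟩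
  exact ⟨a ≫ b, by rw [← Category.assoc, ha, hb]⟩

variable (C L) in
/-- The (large) sub-preorder M of [σFilt(L), RegEpi(A)]: monotone maps preserving
finite infima and arbitrary suprema, whose images consist of pairwise ker-commuting
regular epimorphisms.  Infima and suprema in σFilt(L) are expressed via IsGLB/IsLUB. -/
structure Msig (A : C) : Type (max u v w) where
  H : SFilt L → RegEpiOver A
  mono : ∀ {k l : SFilt L}, k ≤ l → (H k).le (H l)
  presInf : ∀ (S : Set (SFilt L)), S.Finite → ∀ m, IsGLB S m →
    (∀ k ∈ S, (H m).le (H k)) ∧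
    ∀ t : RegEpiOver A, (∀ k ∈ S, t.le (H k)) → t.le (H m)
  presSup : ∀ (S : Set (SFilt L)) (j : SFilt L), IsLUB S j →
    (∀ k ∈ S, (H k).le (H j)) ∧
    ∀ t : RegEpiOver A, (∀ k ∈ S, (H k).le t) → (H j).le t
  kercomm : ∀ k l : SFilt L, KerCommute (H k) (H l)

/-- M as a (pre)category: morphisms are pointwise inequalities in RegEpi(A). -/
instance {A : C} : Category (Msig C L A) where
  Hom X Y := PLift (∀ k : SFilt L, (X.H k).le (Y.H k))
  id X := ⟨fun k => RegEpiOver.le_refl' _⟩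
  comp f g := ⟨fun k => RegEpiOver.le_trans' (f.down k) (g.down k)⟩
  id_comp f := rfl
  comp_id f := rfl
  assoc f g h := rfl

end Msig

section RegularCategories

theorem CategoryTheory.RegularEpi.strongEpi_of_nonempty {X Y : C} {f : X ⟶ Y}
    (hf : Nonempty (RegularEpi f)) : StrongEpi f := by
  have : IsRegularEpi f := ⟨hf⟩
  infer_instance

theorem RegularCat.regularEpi_of_strongEpi [RegularCat C] {X Y : C} (f : X ⟶ Y) [StrongEpi f] :
    Nonempty (RegularEpi f) := by
  obtain ⟨Z, e, m, he, hm, hf⟩ := RegularCat.factor f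
  have : StrongEpi (e ≫ m) := hf ▸ inferInstance
  have : StrongEpi m := strongEpi_of_strongEpi e m
  have : IsIso m := isIso_of_mono_of_strongEpi m
  exact he.map fun r => RegularEpi.ofArrowIso
    (Arrow.isoMk (Iso.refl _) (asIso m) (by simp [hf]) : Arrow.mk e ≅ Arrow.mk f) r

theorem RegularCat.strongEpi_snd [RegularCat C] {P X Y Z : C} {a : P ⟶ X} {b : P ⟶ Z}
    {f : X ⟶ Y} {g : Z ⟶ Y} (h : IsPullback a b f g) [StrongEpi f] : StrongEpi b := by
  have h₁ : StrongEpi (pullback.snd f g) := RegularEpi.strongEpi_of_nonempty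
    (RegularCat.stable f g (RegularCat.regularEpi_of_strongEpi f))
  rw [← h.isoPullback_hom_snd]
  exact strongEpi_comp _ _

theorem RegularCat.exists_factor [RegularCat C] {X Y : C} (f : X ⟶ Y) :
    ∃ (Z : C) (e : X ⟶ Z) (m : Z ⟶ Y), StrongEpi e ∧ Mono m ∧ e ≫ m = f := by
  obtain ⟨Z, e, m, he, hm, hf⟩ := RegularCat.factor f
  exact ⟨Z, e, m, RegularEpi.strongEpi_of_nonempty he, hm, hf⟩

/-- A strong epimorphism in a regular category is the coequaliser of its kernel pair. -/
theorem RegularCat.exists_desc [RegularCat C] {X Y T : C} (f : X ⟶ Y) [StrongEpi f] (k : X ⟶ T)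
    (hk : ∀ (Z : C) (a b : Z ⟶ X), a ≫ f = b ≫ f → a ≫ k = b ≫ k) :
    ∃ h : Y ⟶ T, f ≫ h = k := by
  obtain ⟨r⟩ := RegularCat.regularEpi_of_strongEpi f
  obtain ⟨l, hl⟩ := r.desc' k (hk _ _ _ r.w)
  exact ⟨l, hl⟩

/-- A pullback square of strong epimorphisms in a regular category is a pushout square. -/
theorem RegularCat.exists_desc_of_isPullback [RegularCat C] {P X Y Z T : C} {a : P ⟶ X}
    {b : P ⟶ Y} {f : X ⟶ Z} {g : Y ⟶ Z} (h : IsPullback a b f g) [StrongEpi f] [StrongEpi g]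
    (s : X ⟶ T) (t : Y ⟶ T) (hst : a ≫ s = b ≫ t) : ∃ u : Z ⟶ T, f ≫ u = s ∧ g ≫ u = t := by
  have hb : StrongEpi b := RegularCat.strongEpi_snd h
  obtain ⟨u, hu⟩ := RegularCat.exists_desc f s (fun W p q hpq => by
    let c := pullback.snd g (p ≫ f)
    have hc : StrongEpi c := RegularCat.strongEpi_snd (IsPullback.of_hasPullback g (p ≫ f))
    have key : ∀ r : W ⟶ X, r ≫ f = p ≫ f →
        c ≫ r ≫ s = pullback.fst g (p ≫ f) ≫ t := fun r hr => by
      have hw : (c ≫ r) ≫ f = pullback.fst g (p ≫ f) ≫ g := by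
        rw [Category.assoc, hr, ← pullback.condition]
      rw [← h.lift_snd (c ≫ r) (pullback.fst g (p ≫ f)) hw, Category.assoc, ← hst,
        h.lift_fst_assoc, Category.assoc]
    rw [← cancel_epi c, key p rfl, key q hpq.symm])
  refine ⟨u, hu, ?_⟩
  rw [← cancel_epi b, ← Category.assoc, ← h.w, Category.assoc, hu, hst]

instance {A : C} (f : RegEpiOver A) : StrongEpi f.hom :=
  RegularEpi.strongEpi_of_nonempty f.regEpi

/-- A strong epimorphism with domain `A`, as an object of `RegEpiOver A`. -/
def RegEpiOver.ofStrongEpi [RegularCat C] {A B : C} (f : A ⟶ B) [StrongEpi f] : RegEpiOver A :=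
  ⟨B, f, RegularCat.regularEpi_of_strongEpi f⟩

theorem kerPairMap_fst {A B : C} (f : A ⟶ B) : kerPairMap f ≫ prod.fst = pullback.fst f f :=
  prod.lift_fst _ _

theorem kerPairMap_snd {A B : C} (f : A ⟶ B) : kerPairMap f ≫ prod.snd = pullback.snd f f :=
  prod.lift_snd _ _

instance kerPairMap_mono {A B : C} (f : A ⟶ B) : Mono (kerPairMap f) := by
  refine ⟨fun a b h => ?_⟩
  apply pullback.hom_ext
  · rw [← kerPairMap_fst, reassoc_of% h]
  · rw [← kerPairMap_snd, reassoc_of% h]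

/-- The domain of the composite of two kernel pairs classifies triples `(x, y, z)` with
`f x = f y` and `g y = g z`. -/
theorem exists_relCompDom_kerPairMap {A X Y : C} (f : A ⟶ X) (g : A ⟶ Y) :
    ∃ a b c : relCompDom (kerPairMap f) (kerPairMap g) ⟶ A,
      a ≫ f = b ≫ f ∧ b ≫ g = c ≫ g ∧
      relCompMap (kerPairMap f) (kerPairMap g) = prod.lift a c ∧
      ∀ {W : C} (x y z : W ⟶ A), x ≫ f = y ≫ f → y ≫ g = z ≫ g →
        ∃ d : W ⟶ relCompDom (kerPairMap f) (kerPairMap g), d ≫ a = x ∧ d ≫ c = z := by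
  let i : relCompDom (kerPairMap f) (kerPairMap g) ⟶ pullback f f ⨯ pullback g g :=
    equalizer.ι _ _
  have hi : i ≫ prod.fst ≫ pullback.snd f f = i ≫ prod.snd ≫ pullback.fst g g := by
    have := equalizer.condition
      ((prod.fst : pullback f f ⨯ pullback g g ⟶ _) ≫ kerPairMap f ≫ (prod.snd : A ⨯ A ⟶ A))
      ((prod.snd : pullback f f ⨯ pullback g g ⟶ _) ≫ kerPairMap g ≫ (prod.fst : A ⨯ A ⟶ A))
    exact (congrArg (i ≫ prod.fst ≫ ·) (kerPairMap_snd f).symm).trans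
      (this.trans (congrArg (i ≫ prod.snd ≫ ·) (kerPairMap_fst g)))
  refine ⟨i ≫ prod.fst ≫ pullback.fst f f, i ≫ prod.fst ≫ pullback.snd f f,
    i ≫ prod.snd ≫ pullback.snd g g, ?_, ?_, ?_, ?_⟩
  · simp only [Category.assoc, pullback.condition]
  · rw [hi]
    simp only [Category.assoc, pullback.condition]
  · apply Limits.prod.hom_ext
    · rw [prod.lift_fst, ← kerPairMap_fst]
      exact (Category.assoc _ _ _).trans (congrArg (i ≫ ·) (prod.lift_fst _ _))
    · rw [prod.lift_snd, ← kerPairMap_snd]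
      exact (Category.assoc _ _ _).trans (congrArg (i ≫ ·) (prod.lift_snd _ _))
  · intro W x y z hxy hyz
    let d : W ⟶ relCompDom (kerPairMap f) (kerPairMap g) :=
      equalizer.lift (prod.lift (pullback.lift x y hxy) (pullback.lift y z hyz))
        (by rw [kerPairMap_fst, kerPairMap_snd, prod.lift_fst_assoc, prod.lift_snd_assoc,
          pullback.lift_snd, pullback.lift_fst])
    have hd : d ≫ i = prod.lift (pullback.lift x y hxy) (pullback.lift y z hyz) :=
      equalizer.lift_ι _ _
    exact ⟨d, by rw [reassoc_of% hd, prod.lift_fst_assoc, pullback.lift_fst],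
      by rw [reassoc_of% hd, prod.lift_snd_assoc, pullback.lift_snd]⟩

theorem isRelComp_kerPairMap [RegularCat C] {A X Y Z P : C} {f : A ⟶ X} {g : A ⟶ Y} {h : A ⟶ Z}
    {p : X ⟶ Z} {q : Y ⟶ Z} {u : P ⟶ X} {v : P ⟶ Y} (hP : IsPullback u v p q)
    (hp : f ≫ p = h) (hq : g ≫ q = h) (m : A ⟶ P) [StrongEpi m] (hu : m ≫ u = f)
    (hv : m ≫ v = g) : IsRelComp (kerPairMap f) (kerPairMap g) (kerPairMap h) := by
  obtain ⟨a, b, c, hab, hbc, hac, hlift⟩ := exists_relCompDom_kerPairMap f g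
  let e : relCompDom (kerPairMap f) (kerPairMap g) ⟶ pullback h h :=
    pullback.lift a c (by rw [← hp, reassoc_of% hab, hp, ← hq, reassoc_of% hbc])
  have hwpq : (pullback.fst h h ≫ f) ≫ p = (pullback.snd h h ≫ g) ≫ q := by
    rw [Category.assoc, Category.assoc, hp, hq, pullback.condition]
  let w : pullback h h ⟶ P := hP.lift _ _ hwpq
  have hw : StrongEpi (pullback.snd m w) :=
    RegularCat.strongEpi_snd (IsPullback.of_hasPullback m w)
  obtain ⟨n, hna, hnc⟩ := hlift (pullback.snd m w ≫ pullback.fst h h) (pullback.fst m w)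
    (pullback.snd m w ≫ pullback.snd h h)
    (by rw [Category.assoc, ← hP.lift_fst _ _ hwpq, ← pullback.condition_assoc, hu])
    (by rw [Category.assoc, ← hP.lift_snd _ _ hwpq, ← pullback.condition_assoc, hv])
  have hne : n ≫ e = pullback.snd m w := by
    apply pullback.hom_ext
    · rw [Category.assoc, pullback.lift_fst, hna]
    · rw [Category.assoc, pullback.lift_snd, hnc]
  have : StrongEpi (n ≫ e) := hne ▸ hw
  have : StrongEpi e := strongEpi_of_strongEpi n e
  refine ⟨e, RegularCat.regularEpi_of_strongEpi e, ?_⟩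
  rw [hac]
  apply Limits.prod.hom_ext
  · rw [Category.assoc, kerPairMap_fst, pullback.lift_fst, prod.lift_fst]
  · rw [Category.assoc, kerPairMap_snd, pullback.lift_snd, prod.lift_snd]

theorem kerCommute_of_isPullback [RegularCat C] {A Z P : C} {f g : RegEpiOver A}
    {p : f.cod ⟶ Z} {q : g.cod ⟶ Z} {u : P ⟶ f.cod} {v : P ⟶ g.cod} (hP : IsPullback u v p q)
    (m : A ⟶ P) [StrongEpi m] (hu : m ≫ u = f.hom) (hv : m ≫ v = g.hom) : KerCommute f g := by
  have hq : g.hom ≫ q = f.hom ≫ p := by rw [← hu, ← hv, Category.assoc, Category.assoc, hP.w]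
  exact ⟨_, kerPairMap (f.hom ≫ p), inferInstance,
    isRelComp_kerPairMap hP rfl hq m hu hv, isRelComp_kerPairMap hP.flip hq rfl m hv hu,
    ⟨_, f.hom ≫ p, ⟨𝟙 _, Category.id_comp _⟩, ⟨𝟙 _, Category.id_comp _⟩⟩⟩

/-- If `f` and `g` ker-commute and `Z` is their supremum, then `A` covers the pullback of
`f` and `g` over `Z`. -/
theorem strongEpi_of_kerCommute [RegularCat C] {A Z P : C} {f g : RegEpiOver A}
    (hfg : KerCommute f g) {p : f.cod ⟶ Z} {q : g.cod ⟶ Z} {u : P ⟶ f.cod} {v : P ⟶ g.cod}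
    (hP : IsPullback u v p q) (hpq : f.hom ≫ p = g.hom ≫ q)
    (hZ : ∀ t : RegEpiOver A, f.le t → g.le t → ∃ s : Z ⟶ t.cod, (f.hom ≫ p) ≫ s = t.hom)
    (m : A ⟶ P) (hu : m ≫ u = f.hom) (hv : m ≫ v = g.hom) : StrongEpi m := by
  obtain ⟨T, t, ht, ⟨e, he, het⟩, -, B, h, ⟨i, hi⟩, ⟨j, hj⟩⟩ := hfg
  have he' := RegularEpi.strongEpi_of_nonempty he
  obtain ⟨B', h', n, hh', hn, rfl⟩ := RegularCat.exists_factor h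
  obtain ⟨a, b, c, hab, hbc, hac, hlift⟩ := exists_relCompDom_kerPairMap f.hom g.hom
  have hac' : a ≫ h' = c ≫ h' := by
    have h₁ : (e ≫ i) ≫ kerPairMap (h' ≫ n) = prod.lift a c := by rw [Category.assoc, hi, het, hac]
    have ha : (e ≫ i) ≫ pullback.fst _ _ = a := by
      rw [← kerPairMap_fst, ← Category.assoc, h₁, prod.lift_fst]
    have hc : (e ≫ i) ≫ pullback.snd _ _ = c := by
      rw [← kerPairMap_snd, ← Category.assoc, h₁, prod.lift_snd]
    rw [← cancel_mono n, ← ha, ← hc]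
    simp only [Category.assoc, pullback.condition]
  have hmem : ∀ {W : C} (x y z : W ⟶ A), x ≫ f.hom = y ≫ f.hom → y ≫ g.hom = z ≫ g.hom →
      x ≫ h' = z ≫ h' := fun {W} x y z hxy hyz => by
    obtain ⟨d, rfl, rfl⟩ := hlift x y z hxy hyz
    rw [Category.assoc, hac', Category.assoc]
  obtain ⟨s, hs⟩ : ∃ s : Z ⟶ B', (f.hom ≫ p) ≫ s = h' := hZ (RegEpiOver.ofStrongEpi h')
    (RegularCat.exists_desc _ _ fun W a b hab => hmem a b b hab rfl)
    (RegularCat.exists_desc _ _ fun W a b hab => hmem a a b rfl hab)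
  -- a cover of `P` by pairs of elements of `A` identified in `Z`
  let c₁ : pullback f.hom u ⟶ P := pullback.snd f.hom u
  let c₂ : pullback g.hom (c₁ ≫ v) ⟶ pullback f.hom u := pullback.snd g.hom (c₁ ≫ v)
  have hc₁ : StrongEpi c₁ := RegularCat.strongEpi_snd (IsPullback.of_hasPullback f.hom u)
  have hc₂ : StrongEpi c₂ := RegularCat.strongEpi_snd (IsPullback.of_hasPullback g.hom (c₁ ≫ v))
  obtain ⟨x, hx⟩ : ∃ x, x ≫ f.hom = (c₂ ≫ c₁) ≫ u :=
    ⟨c₂ ≫ pullback.fst f.hom u, by simp only [c₁, Category.assoc, pullback.condition]⟩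
  obtain ⟨z, hz⟩ : ∃ z, z ≫ g.hom = (c₂ ≫ c₁) ≫ v :=
    ⟨pullback.fst g.hom (c₁ ≫ v), by simp only [c₂, Category.assoc, pullback.condition]⟩
  have hxz : x ≫ h' ≫ n = z ≫ h' ≫ n := by
    have : x ≫ f.hom ≫ p = z ≫ f.hom ≫ p := by
      rw [reassoc_of% hx, hpq, reassoc_of% hz, hP.w]
    rw [← hs]
    simp only [Category.assoc] at this ⊢
    rw [reassoc_of% this]
  let k : pullback g.hom (c₁ ≫ v) ⟶ T := pullback.lift x z hxz ≫ j
  have hk : k ≫ t = prod.lift x z := by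
    rw [Category.assoc, hj]
    apply Limits.prod.hom_ext
    · rw [Category.assoc, kerPairMap_fst, pullback.lift_fst, prod.lift_fst]
    · rw [Category.assoc, kerPairMap_snd, pullback.lift_snd, prod.lift_snd]
  have hV : StrongEpi (pullback.snd e k) :=
    RegularCat.strongEpi_snd (IsPullback.of_hasPullback e k)
  have hV' : pullback.fst e k ≫ prod.lift a c = pullback.snd e k ≫ prod.lift x z := by
    rw [← hac, ← het, pullback.condition_assoc, hk]
  have h₁ : pullback.fst e k ≫ a = pullback.snd e k ≫ x := by
    simpa only [Category.assoc, prod.lift_fst] using congrArg (· ≫ prod.fst) hV'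
  have h₂ : pullback.fst e k ≫ c = pullback.snd e k ≫ z := by
    simpa only [Category.assoc, prod.lift_snd] using congrArg (· ≫ prod.snd) hV'
  have hb : (pullback.fst e k ≫ b) ≫ m = pullback.snd e k ≫ c₂ ≫ c₁ := by
    apply hP.hom_ext
    · simp only [Category.assoc, hu]
      rw [← hab, reassoc_of% h₁, hx, Category.assoc]
    · simp only [Category.assoc, hv]
      rw [hbc, reassoc_of% h₂, hz, Category.assoc]
  have : StrongEpi ((pullback.fst e k ≫ b) ≫ m) := by
    rw [hb]
    have := strongEpi_comp c₂ c₁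
    exact strongEpi_comp _ _
  exact strongEpi_of_strongEpi (pullback.fst e k ≫ b) m

end RegularCategories

section StablyContinuousLattices

/-- A complete lattice is stably continuous if it is continuous and its way-below relation is
multiplicative, with compact top element. -/
class StablyContinuous (L : Type w) [CompleteLattice L] : Prop where
  wb_nonempty : ∀ x : L, (wb x).Nonempty
  wb_directed : ∀ x : L, DirectedOn (· ≤ ·) (wb x)
  wb_isLUB : ∀ x : L, IsLUB (wb x) x
  top_wayBelow_top : WayBelow (⊤ : L) ⊤
  wayBelow_inf : ∀ x y z : L, WayBelow x y → WayBelow x z → WayBelow x (y ⊓ z)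

variable {L : Type w} [CompleteLattice L]

theorem WayBelow.le {x y : L} (h : WayBelow x y) : x ≤ y := by
  obtain ⟨d, rfl, hd⟩ := h {y} (Set.singleton_nonempty y) (directedOn_singleton y) y
    isLUB_singleton le_rfl
  exact hd

theorem WayBelow.mono {x' x y y' : L} (hx : x' ≤ x) (h : WayBelow x y) (hy : y ≤ y') :
    WayBelow x' y' := fun D hD hD' s hs hys => by
  obtain ⟨d, hd, hxd⟩ := h D hD hD' s hs (hy.trans hys)
  exact ⟨d, hd, hx.trans hxd⟩

theorem WayBelow.sup {x x' y : L} (h : WayBelow x y) (h' : WayBelow x' y) :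
    WayBelow (x ⊔ x') y := fun D hD hD' s hs hys => by
  obtain ⟨d, hd, hxd⟩ := h D hD hD' s hs hys
  obtain ⟨e, he, hxe⟩ := h' D hD hD' s hs hys
  obtain ⟨f, hf, hdf, hef⟩ := hD' d hd e he
  exact ⟨f, hf, sup_le (hxd.trans hdf) (hxe.trans hef)⟩

/-- Interpolation for the way-below relation. -/
theorem WayBelow.exists_between [StablyContinuous L] {x y : L} (h : WayBelow x y) :
    ∃ z, WayBelow x z ∧ WayBelow z y := by
  obtain ⟨d, ⟨z, hdz, hzy⟩, hxd⟩ := h {d | ∃ z, WayBelow d z ∧ WayBelow z y}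
    (by
      obtain ⟨z, hz⟩ := StablyContinuous.wb_nonempty y
      obtain ⟨d, hd⟩ := StablyContinuous.wb_nonempty z
      exact ⟨d, z, hd, hz⟩)
    (by
      rintro d ⟨z, hdz, hzy⟩ e ⟨z', hez, hzy'⟩
      exact ⟨d ⊔ e, ⟨z ⊔ z', (hdz.mono le_rfl le_sup_left).sup (hez.mono le_rfl le_sup_right),
        hzy.sup hzy'⟩, le_sup_left, le_sup_right⟩)
    y
    ⟨fun d ⟨z, hdz, hzy⟩ => hdz.le.trans hzy.le, fun b hb =>
      (StablyContinuous.wb_isLUB y).2 fun z hz => (StablyContinuous.wb_isLUB z).2 fun d hd =>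
        hb ⟨z, hd, hz⟩⟩ le_rfl
  exact ⟨z, hdz.mono hxd le_rfl, hzy⟩

namespace SFilt

theorem mem_of_le (k : SFilt L) {x y : L} (hx : x ∈ k.1) (h : x ≤ y) : y ∈ k.1 :=
  k.2.1.2.1 x hx y h

theorem top_mem (k : SFilt L) : (⊤ : L) ∈ k.1 :=
  k.2.1.1.elim fun _ hx => k.mem_of_le hx le_top

theorem inf_mem (k : SFilt L) {x y : L} (hx : x ∈ k.1) (hy : y ∈ k.1) : x ⊓ y ∈ k.1 := by
  obtain ⟨z, hz, hzx, hzy⟩ := k.2.1.2.2 x hx y hy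
  exact k.mem_of_le hz (le_inf hzx hzy)

theorem exists_wayBelow [StablyContinuous L] (k : SFilt L) {x : L} (hx : x ∈ k.1) :
    ∃ y ∈ k.1, WayBelow y x := by
  obtain ⟨y, hy, hyk⟩ := k.2.2 _ (StablyContinuous.wb_nonempty x) (StablyContinuous.wb_directed x)
    x (StablyContinuous.wb_isLUB x) hx
  exact ⟨y, hyk, hy⟩

variable (L) in
/-- The improper filter. -/
def univ : SFilt L :=
  ⟨Set.univ, ⟨⟨⊤, trivial⟩, fun _ _ _ _ => trivial, fun x _ y _ =>
    ⟨x ⊓ y, trivial, inf_le_left, inf_le_right⟩⟩, fun _ ⟨d, hd⟩ _ _ _ _ => ⟨d, hd, trivial⟩⟩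

theorem le_univ (k : SFilt L) : k ≤ univ L := fun _ _ => trivial

variable (L) in
/-- The filter consisting of the top element only. -/
def single [StablyContinuous L] : SFilt L :=
  ⟨{⊤}, ⟨⟨⊤, rfl⟩, by rintro _ rfl y hy; exact top_le_iff.1 hy,
    by rintro _ rfl _ rfl; exact ⟨⊤, rfl, le_rfl, le_rfl⟩⟩, fun D hD hD' s hs hsD => by
      obtain ⟨d, hd, h⟩ := StablyContinuous.top_wayBelow_top D hD hD' s hs (le_of_eq hsD.symm)
      exact ⟨d, hd, top_le_iff.1 h⟩⟩

theorem single_le [StablyContinuous L] (k : SFilt L) : single L ≤ k := by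
  rintro _ rfl
  exact k.top_mem

/-- The intersection of two Scott-open filters. -/
def inter (k l : SFilt L) : SFilt L :=
  ⟨k.1 ∩ l.1, ⟨⟨⊤, k.top_mem, l.top_mem⟩, fun _ hx _ h => ⟨k.mem_of_le hx.1 h, l.mem_of_le hx.2 h⟩,
    fun x hx y hy => ⟨x ⊓ y, ⟨k.inf_mem hx.1 hy.1, l.inf_mem hx.2 hy.2⟩, inf_le_left,
      inf_le_right⟩⟩, fun D hD hD' s hs hsD => by
      obtain ⟨d, hd, hdk⟩ := k.2.2 D hD hD' s hs hsD.1
      obtain ⟨e, he, hel⟩ := l.2.2 D hD hD' s hs hsD.2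
      obtain ⟨f, hf, hdf, hef⟩ := hD' d hd e he
      exact ⟨f, hf, k.mem_of_le hdk hdf, l.mem_of_le hel hef⟩⟩

theorem inter_le_left (k l : SFilt L) : inter k l ≤ k := fun _ h => h.1

theorem inter_le_right (k l : SFilt L) : inter k l ≤ l := fun _ h => h.2

theorem le_inter {k l m : SFilt L} (hk : m ≤ k) (hl : m ≤ l) : m ≤ inter k l :=
  fun _ h => ⟨hk h, hl h⟩

/-- The filter generated by two Scott-open filters. -/
def join [StablyContinuous L] (k l : SFilt L) : SFilt L :=
  ⟨{z | ∃ x ∈ k.1, ∃ y ∈ l.1, x ⊓ y ≤ z}, ⟨⟨⊤, ⊤, k.top_mem, ⊤, l.top_mem, le_top⟩,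
    fun _ ⟨x, hx, y, hy, h⟩ _ h' => ⟨x, hx, y, hy, h.trans h'⟩,
    fun z ⟨x, hx, y, hy, h⟩ z' ⟨x', hx', y', hy', h'⟩ => ⟨z ⊓ z', ⟨x ⊓ x', k.inf_mem hx hx', y ⊓ y',
      l.inf_mem hy hy', (inf_inf_inf_comm x x' y y').trans_le (inf_le_inf h h')⟩, inf_le_left,
      inf_le_right⟩⟩, fun D hD hD' s hs ⟨x, hx, y, hy, h⟩ => by
      obtain ⟨x', hxk, hx'⟩ := k.exists_wayBelow hx
      obtain ⟨y', hyl, hy'⟩ := l.exists_wayBelow hy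
      obtain ⟨d, hd, h'⟩ := StablyContinuous.wayBelow_inf (x' ⊓ y') x y
        (hx'.mono inf_le_left le_rfl) (hy'.mono inf_le_right le_rfl) D hD hD' s hs h
      exact ⟨d, hd, x', hxk, y', hyl, h'⟩⟩

theorem le_join_left [StablyContinuous L] (k l : SFilt L) : k ≤ join k l :=
  fun x hx => ⟨x, hx, ⊤, l.top_mem, inf_le_left⟩

theorem le_join_right [StablyContinuous L] (k l : SFilt L) : l ≤ join k l :=
  fun x hx => ⟨⊤, k.top_mem, x, hx, inf_le_right⟩

theorem inf_mem_join [StablyContinuous L] {k l : SFilt L} {x y : L} (hx : x ∈ k.1) (hy : y ∈ l.1) :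
    x ⊓ y ∈ (join k l).1 :=
  ⟨x, hx, y, hy, le_rfl⟩

theorem join_le [StablyContinuous L] {k l m : SFilt L} (hk : k ≤ m) (hl : l ≤ m) :
    join k l ≤ m := fun _ ⟨_, hx, _, hy, h⟩ => m.mem_of_le (m.inf_mem (hk hx) (hl hy)) h

/-- The Scott-open filter of all elements way above a given one. -/
def above [StablyContinuous L] (x : L) : SFilt L :=
  ⟨{y | WayBelow x y}, ⟨⟨⊤, StablyContinuous.top_wayBelow_top.mono le_top le_rfl⟩,
    fun _ h _ h' => WayBelow.mono le_rfl h h', fun y hy z hz => ⟨y ⊓ z,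
      StablyContinuous.wayBelow_inf x y z hy hz, inf_le_left, inf_le_right⟩⟩,
    fun D hD hD' s hs h => by
      obtain ⟨z, hxz, hzs⟩ := WayBelow.exists_between h
      obtain ⟨d, hd, hzd⟩ := hzs D hD hD' s hs le_rfl
      exact ⟨d, hd, hxz.mono le_rfl hzd⟩⟩

theorem above_le [StablyContinuous L] {k : SFilt L} {x : L} (hx : x ∈ k.1) : above x ≤ k :=
  fun _ h => k.mem_of_le hx (WayBelow.le h)

theorem above_anti [StablyContinuous L] {x y : L} (h : x ≤ y) : above y ≤ above x :=
  fun _ hz => WayBelow.mono h hz le_rfl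

/-- Every Scott-open filter containing a binary join contains the intersection of two Scott-open
filters that contain the respective elements. -/
theorem exists_inter_le [StablyContinuous L] (k : SFilt L) {x y : L} (h : x ⊔ y ∈ k.1) :
    ∃ a b : SFilt L, x ∈ a.1 ∧ y ∈ b.1 ∧ inter a b ≤ k := by
  obtain ⟨_, ⟨x', y', hx, hy, rfl⟩, hk⟩ :=
    k.2.2 {z | ∃ x' y', WayBelow x' x ∧ WayBelow y' y ∧ z = x' ⊔ y'}
      (by
        obtain ⟨x', hx⟩ := StablyContinuous.wb_nonempty x
        obtain ⟨y', hy⟩ := StablyContinuous.wb_nonempty y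
        exact ⟨_, x', y', hx, hy, rfl⟩)
      (by
        rintro _ ⟨x', y', hx, hy, rfl⟩ _ ⟨x'', y'', hx', hy', rfl⟩
        exact ⟨_, ⟨_, _, hx.sup hx', hy.sup hy', rfl⟩, sup_le_sup le_sup_left le_sup_left,
          sup_le_sup le_sup_right le_sup_right⟩)
      (x ⊔ y)
      (by
        obtain ⟨x₀, hx₀⟩ := StablyContinuous.wb_nonempty x
        obtain ⟨y₀, hy₀⟩ := StablyContinuous.wb_nonempty y
        refine ⟨?_, fun b hb => sup_le ((StablyContinuous.wb_isLUB x).2 fun x' hx => ?_)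
          ((StablyContinuous.wb_isLUB y).2 fun y' hy => ?_)⟩
        · rintro _ ⟨x', y', hx, hy, rfl⟩
          exact sup_le_sup hx.le hy.le
        · exact le_sup_left.trans (hb ⟨x', y₀, hx, hy₀, rfl⟩)
        · exact le_sup_right.trans (hb ⟨x₀, y', hx₀, hy, rfl⟩)) h
  exact ⟨above x', above y', hx, hy, fun z hz => k.mem_of_le hk (sup_le (WayBelow.le hz.1)
    (WayBelow.le hz.2))⟩

/-- The union of a directed family of Scott-open filters. -/
def directedUnion (S : Set (SFilt L)) (hS : S.Nonempty) (hS' : DirectedOn (· ≤ ·) S) : SFilt L :=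
  ⟨{x | ∃ k ∈ S, x ∈ k.1}, ⟨hS.elim fun k hk => ⟨⊤, k, hk, k.top_mem⟩,
    fun _ ⟨k, hk, hx⟩ _ h => ⟨k, hk, k.mem_of_le hx h⟩,
    fun x ⟨k, hk, hx⟩ y ⟨l, hl, hy⟩ => by
      obtain ⟨m, hm, hkm, hlm⟩ := hS' k hk l hl
      exact ⟨x ⊓ y, ⟨m, hm, m.inf_mem (hkm hx) (hlm hy)⟩, inf_le_left, inf_le_right⟩⟩,
    fun D hD hD' s hs ⟨k, hk, hsk⟩ => by
      obtain ⟨d, hd, hdk⟩ := k.2.2 D hD hD' s hs hsk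
      exact ⟨d, hd, k, hk, hdk⟩⟩

theorem isGLB_inter (k l : SFilt L) : IsGLB {k, l} (inter k l) :=
  ⟨by rintro _ (rfl | rfl); exacts [inter_le_left _ _, inter_le_right _ _],
    fun _ hm => le_inter (hm (Or.inl rfl)) (hm (Or.inr rfl))⟩

theorem isLUB_join [StablyContinuous L] (k l : SFilt L) : IsLUB {k, l} (join k l) :=
  ⟨by rintro _ (rfl | rfl); exacts [le_join_left _ _, le_join_right _ _],
    fun _ hm => join_le (hm (Or.inl rfl)) (hm (Or.inr rfl))⟩

theorem isGLB_univ : IsGLB ∅ (univ L) :=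
  ⟨fun _ h => h.elim, fun k _ => k.le_univ⟩

theorem isLUB_single [StablyContinuous L] : IsLUB ∅ (single L) :=
  ⟨fun _ h => h.elim, fun k _ => k.single_le⟩

/-- A Scott-open filter is the directed union of the filters `above x` for its elements `x`. -/
theorem isLUB_above [StablyContinuous L] (k : SFilt L) :
    IsLUB {l | ∃ x ∈ k.1, l = above x} k := by
  refine ⟨?_, fun m hm x hx => ?_⟩
  · rintro _ ⟨x, hx, rfl⟩
    exact above_le hx
  · obtain ⟨y, hy, hyx⟩ := k.exists_wayBelow hx
    exact hm ⟨y, hy, rfl⟩ hyx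

/-- An inductive property of Scott-open filters closed under finite joins and directed unions
is closed under arbitrary suprema. -/
theorem of_isLUB [StablyContinuous L] {P : SFilt L → Prop} (hanti : ∀ {k l}, k ≤ l → P l → P k)
    (hsingle : P (single L)) (hjoin : ∀ k l, P k → P l → P (join k l))
    (hunion : ∀ S hS hS', (∀ k ∈ S, P k) → P (directedUnion S hS hS'))
    {S : Set (SFilt L)} (hS : ∀ k ∈ S, P k) {j : SFilt L} (hj : IsLUB S j) : P j := by
  have h : P (directedUnion {k | P k} ⟨_, hsingle⟩ fun k hk l hl => ⟨join k l, hjoin k l hk hl,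
      le_join_left k l, le_join_right k l⟩) := hunion _ _ _ fun _ hk => hk
  refine hanti (hj.2 ?_) h
  exact fun k hk _ hx => ⟨k, hS k hk, hx⟩

/-- An upward-closed property of Scott-open filters closed under finite intersections
is closed under finite infima. -/
theorem of_isGLB {P : SFilt L → Prop} (hmono : ∀ {k l}, k ≤ l → P k → P l)
    (huniv : P (univ L)) (hinter : ∀ k l, P k → P l → P (inter k l))
    {S : Set (SFilt L)} (hfin : S.Finite) (hS : ∀ k ∈ S, P k) {m : SFilt L} (hm : IsGLB S m) :
    P m := by
  have : ∃ l, P l ∧ ∀ k ∈ S, l ≤ k := by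
    clear hm
    induction S, hfin using Set.Finite.induction_on with
    | empty => exact ⟨univ L, huniv, fun _ h => h.elim⟩
    | insert _ _ ih =>
      obtain ⟨l, hl, hl'⟩ := ih fun k hk => hS k (Or.inr hk)
      refine ⟨inter _ l, hinter _ _ (hS _ (Or.inl rfl)) hl, ?_⟩
      rintro k (rfl | hk)
      · exact inter_le_left _ _
      · exact (inter_le_right _ _).trans (hl' k hk)
  obtain ⟨l, hl, hl'⟩ := this
  exact hmono (hm.2 hl') hl

end SFilt

end StablyContinuousLattices

section Stalks

variable {L : Type w} [CompleteLattice L]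

theorem map_homOfLE_comp (F : Lᵒᵖ ⥤ C) {x y z : L} (h : x ≤ y) (h' : y ≤ z) :
    F.map (homOfLE h').op ≫ F.map (homOfLE h).op = F.map (homOfLE (h.trans h')).op :=
  (F.map_comp _ _).symm

theorem map_homOfLE_self (F : Lᵒᵖ ⥤ C) {x : L} (h : x ≤ x) :
    F.map (homOfLE h).op = 𝟙 _ :=
  F.map_id _

/-- The restriction of a presheaf to a Scott-open filter. -/
def stalkDiagram (F : Lᵒᵖ ⥤ C) (k : SFilt L) : (k.1 : Set L)ᵒᵈ ⥤ C where
  obj x := F.obj (op (OrderDual.ofDual x).1)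
  map {x y} f := F.map
    (homOfLE (show (OrderDual.ofDual y).1 ≤ (OrderDual.ofDual x).1 from leOfHom f)).op
  map_id _ := F.map_id _
  map_comp _ _ := F.map_comp _ _

instance (k : SFilt L) : Nonempty (k.1 : Set L)ᵒᵈ := ⟨OrderDual.toDual ⟨⊤, k.top_mem⟩⟩

instance (k : SFilt L) : IsDirected (k.1 : Set L)ᵒᵈ (· ≤ ·) :=
  ⟨fun x y => ⟨OrderDual.toDual ⟨(OrderDual.ofDual x).1 ⊓ (OrderDual.ofDual y).1,
    k.inf_mem (OrderDual.ofDual x).2 (OrderDual.ofDual y).2⟩,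
    show _ ⊓ _ ≤ (OrderDual.ofDual x).1 from inf_le_left,
    show _ ⊓ _ ≤ (OrderDual.ofDual y).1 from inf_le_right⟩⟩

/-- Pairs of elements of two filters, ordered by reverse componentwise order. -/
def SFilt.Pairs (k l : SFilt L) : Type w := (k.1 : Set L)ᵒᵈ × (l.1 : Set L)ᵒᵈ

instance (k l : SFilt L) : PartialOrder (SFilt.Pairs k l) :=
  inferInstanceAs (PartialOrder ((k.1 : Set L)ᵒᵈ × (l.1 : Set L)ᵒᵈ))

instance (k l : SFilt L) : Nonempty (SFilt.Pairs k l) :=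
  inferInstanceAs (Nonempty ((k.1 : Set L)ᵒᵈ × (l.1 : Set L)ᵒᵈ))

instance (k l : SFilt L) : IsDirected (SFilt.Pairs k l) (· ≤ ·) := ⟨fun a b => by
  obtain ⟨x, hx, hx'⟩ := directed_of (α := (k.1 : Set L)ᵒᵈ) (· ≤ ·) a.1 b.1
  obtain ⟨y, hy, hy'⟩ := directed_of (α := (l.1 : Set L)ᵒᵈ) (· ≤ ·) a.2 b.2
  exact ⟨(x, y), ⟨hx, hy⟩, ⟨hx', hy'⟩⟩⟩

variable [HasColimitsOfSize.{w, w} C]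

/-- The stalk of a presheaf at a Scott-open filter. -/
noncomputable def stalk (F : Lᵒᵖ ⥤ C) (k : SFilt L) : C := colimit (stalkDiagram F k)

namespace stalk

/-- The canonical map to the stalk. -/
noncomputable def ι (F : Lᵒᵖ ⥤ C) (k : SFilt L) {x : L} (hx : x ∈ k.1) :
    F.obj (op x) ⟶ stalk F k :=
  colimit.ι (stalkDiagram F k) (OrderDual.toDual ⟨x, hx⟩)

variable {F G : Lᵒᵖ ⥤ C} {k l : SFilt L}

theorem map_ι {x y : L} (h : x ≤ y) (hx : x ∈ k.1) (hy : y ∈ k.1) :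
    F.map (homOfLE h).op ≫ ι F k hx = ι F k hy :=
  colimit.w (stalkDiagram F k)
    (homOfLE (show OrderDual.toDual (⟨y, hy⟩ : (k.1 : Set L)) ≤ OrderDual.toDual ⟨x, hx⟩ from h))

theorem hom_ext {B : C} {f g : stalk F k ⟶ B}
    (h : ∀ (x : L) (hx : x ∈ k.1), ι F k hx ≫ f = ι F k hx ≫ g) : f = g :=
  colimit.hom_ext fun x => h _ (OrderDual.ofDual x).2

/-- The universal property of stalks. -/
noncomputable def desc {B : C} (c : ∀ x ∈ k.1, F.obj (op x) ⟶ B)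
    (hc : ∀ (x y : L) (hx : x ∈ k.1) (hy : y ∈ k.1) (h : x ≤ y),
      F.map (homOfLE h).op ≫ c x hx = c y hy) : stalk F k ⟶ B :=
  colimit.desc (stalkDiagram F k) ⟨B, fun x => c _ (OrderDual.ofDual x).2, fun _ _ f =>
    (hc _ _ _ _ (leOfHom f)).trans (Category.comp_id _).symm⟩

theorem ι_desc {B : C} (c : ∀ x ∈ k.1, F.obj (op x) ⟶ B)
    (hc : ∀ (x y : L) (hx : x ∈ k.1) (hy : y ∈ k.1) (h : x ≤ y),
      F.map (homOfLE h).op ≫ c x hx = c y hy) {x : L} (hx : x ∈ k.1) :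
    ι F k hx ≫ desc c hc = c x hx :=
  colimit.ι_desc _ _

/-- Stalks are covariant in the presheaf and in the filter. -/
noncomputable def map (α : F ⟶ G) (h : k ≤ l) : stalk F k ⟶ stalk G l :=
  desc (fun x hx => α.app (op x) ≫ ι G l (h hx)) fun _ _ _ _ _ => by
    rw [← Category.assoc, α.naturality, Category.assoc, map_ι]

theorem ι_map (α : F ⟶ G) (h : k ≤ l) {x : L} (hx : x ∈ k.1) :
    ι F k hx ≫ map α h = α.app (op x) ≫ ι G l (h hx) :=
  ι_desc _ _ _

theorem ι_map_id (h : k ≤ l) {x : L} (hx : x ∈ k.1) :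
    ι F k hx ≫ map (𝟙 F) h = ι F l (h hx) := by
  rw [ι_map, NatTrans.id_app, Category.id_comp]

theorem exists_colimit_iso {J : Type w} [PartialOrder J] [Nonempty J] [IsDirected J (· ≤ ·)]
    (D : J ⥤ Lᵒᵖ) (hD : ∀ j, (D.obj j).unop ∈ k.1) (hk : ∀ x ∈ k.1, ∃ j, (D.obj j).unop ≤ x) :
    ∃ e : colimit (D ⋙ F) ≅ stalk F k, ∀ j, colimit.ι (D ⋙ F) j ≫ e.hom = ι F k (hD j) := by
  let E : J ⥤ (k.1 : Set L)ᵒᵈ :=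
    { obj := fun j => OrderDual.toDual ⟨(D.obj j).unop, hD j⟩
      map := fun f => homOfLE (show (D.obj _).unop ≤ (D.obj _).unop from leOfHom (D.map f).unop) }
  have : E.Final := Functor.final_of_exists_of_isFiltered E (fun x => by
      obtain ⟨j, hj⟩ := hk _ (OrderDual.ofDual x).2
      exact ⟨j, ⟨homOfLE hj⟩⟩) fun {_ c} _ _ => ⟨c, 𝟙 c, Subsingleton.elim _ _⟩
  exact ⟨Functor.Final.colimitIso E (stalkDiagram F k),
    fun j => Functor.Final.ι_colimitIso_hom E (stalkDiagram F k) j⟩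

theorem colimMap_comp_of_iso {J : Type w} [PartialOrder J] {D E : J ⥤ Lᵒᵖ} (p : D ⟶ E) (h : k ≤ l)
    {hD : ∀ j, (D.obj j).unop ∈ k.1} {hE : ∀ j, (E.obj j).unop ∈ l.1}
    {d : colimit (D ⋙ F) ≅ stalk F k} {e : colimit (E ⋙ F) ≅ stalk F l}
    (hd : ∀ j, colimit.ι (D ⋙ F) j ≫ d.hom = ι F k (hD j))
    (he : ∀ j, colimit.ι (E ⋙ F) j ≫ e.hom = ι F l (hE j)) :
    colim.map (Functor.whiskerRight p F) ≫ e.hom = d.hom ≫ map (𝟙 F) h := by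
  refine colimit.hom_ext fun j => ?_
  rw [← Category.assoc, colim_map, ι_colimMap, Category.assoc, he, ← Category.assoc, hd, ι_map_id]
  exact map_ι (leOfHom (p.app j).unop) _ _

variable [StablyContinuous L]

/-- The stalk functor turns the square formed by two filters, their intersection and their join
into a pullback. -/
theorem isPullback (hcomm : ∀ (J : Type w) [PartialOrder J] [Nonempty J] [IsDirected J (· ≤ ·)],
    PreservesFiniteLimits (colim (J := J) (C := C)))
    (hF : ∀ x y : L, IsPullback (F.map (homOfLE (le_sup_left : x ≤ x ⊔ y)).op)
      (F.map (homOfLE (le_sup_right : y ≤ x ⊔ y)).op)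
      (F.map (homOfLE (inf_le_left : x ⊓ y ≤ x)).op)
      (F.map (homOfLE (inf_le_right : x ⊓ y ≤ y)).op)) (k l : SFilt L) :
    IsPullback (map (𝟙 F) (SFilt.inter_le_left k l)) (map (𝟙 F) (SFilt.inter_le_right k l))
      (map (𝟙 F) (SFilt.le_join_left k l)) (map (𝟙 F) (SFilt.le_join_right k l)) := by
  let J := SFilt.Pairs k l
  let X (j : J) : L := (OrderDual.ofDual j.1).1
  let Y (j : J) : L := (OrderDual.ofDual j.2).1
  have hX {i j : J} (h : i ≤ j) : X j ≤ X i := h.1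
  have hY {i j : J} (h : i ≤ j) : Y j ≤ Y i := h.2
  let dX : J ⥤ Lᵒᵖ := { obj := fun j => op (X j), map := fun f => (homOfLE (hX (leOfHom f))).op }
  let dY : J ⥤ Lᵒᵖ := { obj := fun j => op (Y j), map := fun f => (homOfLE (hY (leOfHom f))).op }
  let dP : J ⥤ Lᵒᵖ :=
    { obj := fun j => op (X j ⊔ Y j)
      map := fun f => (homOfLE (sup_le_sup (hX (leOfHom f)) (hY (leOfHom f)))).op }
  let dZ : J ⥤ Lᵒᵖ :=
    { obj := fun j => op (X j ⊓ Y j)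
      map := fun f => (homOfLE (inf_le_inf (hX (leOfHom f)) (hY (leOfHom f)))).op }
  let pX : dP ⟶ dX := { app := fun j => (homOfLE le_sup_left).op }
  let pY : dP ⟶ dY := { app := fun j => (homOfLE le_sup_right).op }
  let qX : dX ⟶ dZ := { app := fun j => (homOfLE inf_le_left).op }
  let qY : dY ⟶ dZ := { app := fun j => (homOfLE inf_le_right).op }
  have hsq : IsPullback (Functor.whiskerRight pX F) (Functor.whiskerRight pY F)
      (Functor.whiskerRight qX F) (Functor.whiskerRight qY F) :=
    IsPullback.of_forall_isPullback_app fun j => hF (X j) (Y j)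
  have := hcomm J
  have hmap := hsq.map (colim (J := J) (C := C))
  obtain ⟨eP, hP⟩ := exists_colimit_iso (F := F) (k := SFilt.inter k l) dP
    (fun j => ⟨k.mem_of_le (OrderDual.ofDual j.1).2 le_sup_left,
      l.mem_of_le (OrderDual.ofDual j.2).2 le_sup_right⟩)
    fun x hx => ⟨(OrderDual.toDual ⟨x, hx.1⟩, OrderDual.toDual ⟨x, hx.2⟩), sup_le le_rfl le_rfl⟩
  obtain ⟨eX, hX⟩ := exists_colimit_iso (F := F) (k := k) dX (fun j => (OrderDual.ofDual j.1).2)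
    fun x hx => ⟨(OrderDual.toDual ⟨x, hx⟩, OrderDual.toDual ⟨⊤, l.top_mem⟩), le_rfl⟩
  obtain ⟨eY, hY⟩ := exists_colimit_iso (F := F) (k := l) dY (fun j => (OrderDual.ofDual j.2).2)
    fun x hx => ⟨(OrderDual.toDual ⟨⊤, k.top_mem⟩, OrderDual.toDual ⟨x, hx⟩), le_rfl⟩
  obtain ⟨eZ, hZ⟩ := exists_colimit_iso (F := F) (k := SFilt.join k l) dZ
    (fun j => SFilt.inf_mem_join (OrderDual.ofDual j.1).2 (OrderDual.ofDual j.2).2)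
    fun z ⟨x, hx, y, hy, h⟩ => ⟨(OrderDual.toDual ⟨x, hx⟩, OrderDual.toDual ⟨y, hy⟩), h⟩
  exact hmap.of_iso eP eX eY eZ (colimMap_comp_of_iso pX _ hP hX) (colimMap_comp_of_iso pY _ hP hY)
    (colimMap_comp_of_iso qX _ hX hZ) (colimMap_comp_of_iso qY _ hY hZ)

end stalk

end Stalks

namespace SoftOmShrRep

variable {L : Type w} [CompleteLattice L] [HasColimitsOfSize.{w, w} C] {A : C}
  (R : SoftOmShrRep C (L := L) A)

/-- The map from the represented object to a stalk. -/
noncomputable def germ (k : SFilt L) : A ⟶ stalk R.F k := R.φ ≫ stalk.ι R.F k k.top_mem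

theorem regularEpi_ι (k : SFilt L) : Nonempty (RegularEpi (stalk.ι R.F k k.top_mem)) := by
  have h := R.soft k.1 k.2 (stalk R.F k) (fun x hx => stalk.ι R.F k hx)
    (fun x y hx hy hxy => stalk.map_ι hxy hx hy)
    (fun B c hc => ⟨stalk.desc c hc, fun x hx => stalk.ι_desc c hc hx, fun u hu =>
      stalk.hom_ext fun x hx => (hu x hx).trans (stalk.ι_desc c hc hx).symm⟩) ⊤ k.top_mem le_rfl
  rwa [map_homOfLE_self, Category.id_comp] at h

instance (k : SFilt L) : StrongEpi (R.germ k) := by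
  have := R.iso
  have := RegularEpi.strongEpi_of_nonempty (R.regularEpi_ι k)
  exact strongEpi_comp _ _

theorem germ_map {R S : SoftOmShrRep C (L := L) A} (α : R ⟶ S) {k l : SFilt L} (h : k ≤ l) :
    R.germ k ≫ stalk.map α.1 h = S.germ l := by
  rw [germ, Category.assoc, stalk.ι_map, ← Category.assoc, α.2]
  rfl

theorem germ_map_id {k l : SFilt L} (h : k ≤ l) :
    R.germ k ≫ stalk.map (𝟙 R.F) h = R.germ l := by
  rw [germ, Category.assoc, stalk.ι_map_id]
  rfl

theorem germ_eq (k : SFilt L) {x : L} (hx : x ∈ k.1) :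
    R.germ k = (R.φ ≫ R.F.map (homOfLE (le_top : x ≤ ⊤)).op) ≫ stalk.ι R.F k hx := by
  rw [Category.assoc, stalk.map_ι _ _ k.top_mem]
  rfl

variable [RegularCat C]

/-- The regular epimorphism from the represented object to a stalk. -/
noncomputable def quot (k : SFilt L) : RegEpiOver A := .ofStrongEpi (R.germ k)

theorem quot_mono {k l : SFilt L} (h : k ≤ l) : (R.quot k).le (R.quot l) :=
  ⟨stalk.map (𝟙 R.F) h, R.germ_map_id h⟩

theorem le_quot_univ (t : RegEpiOver A) : t.le (R.quot (SFilt.univ L)) := by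
  have := R.osheaf.1
  refine RegularCat.exists_desc t.hom _ fun Z a b _ => ?_
  have h : (a ≫ R.φ) ≫ R.F.map (homOfLE (le_top : ⊥ ≤ (⊤ : L))).op =
      (b ≫ R.φ) ≫ R.F.map (homOfLE (le_top : ⊥ ≤ (⊤ : L))).op := by
    rw [← cancel_mono (terminal.from _)]
    exact Subsingleton.elim _ _
  change a ≫ R.germ _ = b ≫ R.germ _
  simp only [R.germ_eq (SFilt.univ L) (x := ⊥) trivial, ← Category.assoc] at h ⊢
  rw [h]

variable [StablyContinuous L]

theorem quot_single_le (t : RegEpiOver A) : (R.quot (SFilt.single L)).le t := by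
  have := R.iso
  refine ⟨stalk.desc (fun x hx => R.F.map (homOfLE (ge_of_eq hx)).op ≫ inv R.φ ≫ t.hom)
    fun x y hx hy hxy => ?_, ?_⟩
  · rw [← Category.assoc, map_homOfLE_comp]
  · change R.germ _ ≫ _ = _
    rw [germ, Category.assoc, stalk.ι_desc, map_homOfLE_self, Category.id_comp,
      IsIso.hom_inv_id_assoc]

theorem quot_directedUnion_le {S : Set (SFilt L)} (hS : S.Nonempty) (hS' : DirectedOn (· ≤ ·) S)
    {t : RegEpiOver A} (h : ∀ k ∈ S, (R.quot k).le t) :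
    (R.quot (SFilt.directedUnion S hS hS')).le t := by
  replace h : ∀ k ∈ S, ∃ d : stalk R.F k ⟶ t.cod, R.germ k ≫ d = t.hom := h
  choose d hd using h
  have hle {k l : SFilt L} (hk : k ∈ S) (hl : l ∈ S) (hkl : k ≤ l) {x : L} (hx : x ∈ k.1) :
      stalk.ι R.F k hx ≫ d k hk = stalk.ι R.F l (hkl hx) ≫ d l hl := by
    have : d k hk = stalk.map (𝟙 R.F) hkl ≫ d l hl := by
      rw [← cancel_epi (R.germ k), hd, ← Category.assoc, germ_map_id, hd]
    rw [this, ← Category.assoc, stalk.ι_map_id]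
  have hind {k l : SFilt L} (hk : k ∈ S) (hl : l ∈ S) {x : L} (hx : x ∈ k.1) (hx' : x ∈ l.1) :
      stalk.ι R.F k hx ≫ d k hk = stalk.ι R.F l hx' ≫ d l hl := by
    obtain ⟨m, hm, hkm, hlm⟩ := hS' k hk l hl
    rw [hle hk hm hkm, hle hl hm hlm]
  choose K hK hxK using fun x (hx : x ∈ (SFilt.directedUnion S hS hS').1) => hx
  refine ⟨stalk.desc (fun x hx => stalk.ι R.F (K x hx) (hxK x hx) ≫ d _ (hK x hx))
    fun x y hx hy hxy => ?_, ?_⟩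
  · rw [← Category.assoc, stalk.map_ι hxy _ ((K x hx).mem_of_le (hxK x hx) hxy)]
    exact hind _ _ _ _
  · change R.germ _ ≫ _ = _
    rw [germ, Category.assoc, stalk.ι_desc, ← Category.assoc]
    exact hd _ _

/-- The map of preorders associated with a soft sheaf representation. -/
noncomputable def toMsig
    (hcomm : ∀ (J : Type w) [PartialOrder J] [Nonempty J] [IsDirected J (· ≤ ·)],
      PreservesFiniteLimits (colim (J := J) (C := C))) : Msig C L A where
  H := R.quot
  mono := R.quot_mono
  presInf S hS m hm := by
    refine ⟨fun k hk => R.quot_mono (hm.1 hk), fun t ht => ?_⟩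
    refine SFilt.of_isGLB (P := fun k => t.le (R.quot k))
      (fun h h' => RegEpiOver.le_trans' h' (R.quot_mono h)) (R.le_quot_univ t) (fun k l => ?_) hS ht hm
    rintro h h'
    obtain ⟨s, hs⟩ : ∃ s : t.cod ⟶ stalk R.F k, t.hom ≫ s = R.germ k := h
    obtain ⟨s', hs'⟩ : ∃ s : t.cod ⟶ stalk R.F l, t.hom ≫ s = R.germ l := h'
    have hP := stalk.isPullback hcomm R.osheaf.2.1 k l
    have hw : s ≫ stalk.map (𝟙 R.F) (SFilt.le_join_left k l) =
        s' ≫ stalk.map (𝟙 R.F) (SFilt.le_join_right k l) := by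
      rw [← cancel_epi t.hom, ← Category.assoc, hs, ← Category.assoc, hs', germ_map_id,
        germ_map_id]
    refine ⟨hP.lift s s' hw, hP.hom_ext ((Category.assoc _ _ _).trans ?_)
      ((Category.assoc _ _ _).trans ?_)⟩
    · rw [hP.lift_fst, hs]
      exact (R.germ_map_id _).symm
    · rw [hP.lift_snd, hs']
      exact (R.germ_map_id _).symm
  presSup S j hj := by
    refine ⟨fun k hk => R.quot_mono (hj.1 hk), fun t ht => ?_⟩
    refine SFilt.of_isLUB (P := fun k => (R.quot k).le t)
      (fun h h' => RegEpiOver.le_trans' (R.quot_mono h) h') (R.quot_single_le t) (fun k l => ?_)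
      (fun S hS hS' h => R.quot_directedUnion_le hS hS' h) ht hj
    rintro h h'
    obtain ⟨s, hs⟩ : ∃ s : stalk R.F k ⟶ t.cod, R.germ k ≫ s = t.hom := h
    obtain ⟨s', hs'⟩ : ∃ s : stalk R.F l ⟶ t.cod, R.germ l ≫ s = t.hom := h'
    have hstrong {k l : SFilt L} (h : k ≤ l) : StrongEpi (stalk.map (𝟙 R.F) h) := by
      have : StrongEpi (R.germ k ≫ stalk.map (𝟙 R.F) h) := by
        rw [germ_map_id]
        infer_instance
      exact strongEpi_of_strongEpi (R.germ k) _
    have := hstrong (SFilt.le_join_left k l)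
    have := hstrong (SFilt.le_join_right k l)
    obtain ⟨u, hu, -⟩ := RegularCat.exists_desc_of_isPullback
      (stalk.isPullback hcomm R.osheaf.2.1 k l) s s' (by
        rw [← cancel_epi (R.germ _), ← Category.assoc, germ_map_id, ← Category.assoc, germ_map_id,
          hs, hs'])
    refine ⟨u, ?_⟩
    change R.germ _ ≫ u = t.hom
    rw [← R.germ_map_id (SFilt.le_join_left k l), Category.assoc, hu, hs]
  kercomm k l :=
    kerCommute_of_isPullback (f := R.quot k) (g := R.quot l)
      (stalk.isPullback hcomm R.osheaf.2.1 k l) (R.germ _) (R.germ_map_id _) (R.germ_map_id _)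

variable (A) in
/-- The functor sending a soft sheaf representation to its associated map of preorders. -/
noncomputable def toMsigFunctor
    (hcomm : ∀ (J : Type w) [PartialOrder J] [Nonempty J] [IsDirected J (· ≤ ·)],
      PreservesFiniteLimits (colim (J := J) (C := C))) :
    SoftOmShrRep C (L := L) A ⥤ Msig C L A where
  obj R := R.toMsig hcomm
  map α := ⟨fun _ => ⟨stalk.map α.1 le_rfl, germ_map α le_rfl⟩⟩

end SoftOmShrRep

namespace Msig

variable {L : Type w} [CompleteLattice L] {A : C} (X : Msig C L A)

/-- The comparison map between two quotients. -/
noncomputable def map {k l : SFilt L} (h : k ≤ l) : (X.H k).cod ⟶ (X.H l).cod :=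
  (X.mono h).choose

theorem hom_map {k l : SFilt L} (h : k ≤ l) : (X.H k).hom ≫ X.map h = (X.H l).hom :=
  (X.mono h).choose_spec

theorem map_map {k l m : SFilt L} (h : k ≤ l) (h' : l ≤ m) :
    X.map h ≫ X.map h' = X.map (h.trans h') := by
  rw [← cancel_epi (X.H k).hom, ← Category.assoc, hom_map, hom_map, hom_map]

theorem map_self {k : SFilt L} (h : k ≤ k) : X.map h = 𝟙 _ := by
  rw [← cancel_epi (X.H k).hom, hom_map, Category.comp_id]

theorem exists_desc_of_isLUB [RegularCat C] {S : Set (SFilt L)} {j : SFilt L} (hj : IsLUB S j)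
    {B : C} (b : A ⟶ B) (h : ∀ k ∈ S, ∃ c : (X.H k).cod ⟶ B, (X.H k).hom ≫ c = b) :
    ∃ u : (X.H j).cod ⟶ B, (X.H j).hom ≫ u = b := by
  obtain ⟨Z, e, m, he, hm, rfl⟩ := RegularCat.exists_factor b
  obtain ⟨s, hs⟩ : ∃ s : (X.H j).cod ⟶ Z, (X.H j).hom ≫ s = e :=
    (X.presSup S j hj).2 (.ofStrongEpi e) fun k hk => by
      obtain ⟨c, hc⟩ := h k hk
      have sq : CommSq e (X.H k).hom m c := ⟨hc.symm⟩
      exact ⟨sq.lift, sq.fac_left⟩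
  exact ⟨s ≫ m, by rw [← Category.assoc, hs]⟩

theorem mono_terminal_from [RegularCat C] : Mono (terminal.from (X.H (SFilt.univ L)).cod) := by
  obtain ⟨Z, e, m, he, hm, -⟩ := RegularCat.exists_factor (terminal.from A)
  obtain ⟨s, hs⟩ : ∃ s : Z ⟶ (X.H (SFilt.univ L)).cod, e ≫ s = (X.H (SFilt.univ L)).hom :=
    (X.presInf ∅ Set.finite_empty _ SFilt.isGLB_univ).2 (.ofStrongEpi e) fun _ h => h.elim
  obtain ⟨r, hr⟩ := RegularCat.exists_desc (X.H (SFilt.univ L)).hom e fun W a b _ => by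
    rw [← cancel_mono m]
    exact Subsingleton.elim _ _
  have hrs : r ≫ s = 𝟙 _ := by
    rw [← cancel_epi (X.H (SFilt.univ L)).hom, ← Category.assoc, hr, hs, Category.comp_id]
  refine ⟨fun a b _ => ?_⟩
  have : a ≫ r = b ≫ r := by
    rw [← cancel_mono m]
    exact Subsingleton.elim _ _
  rw [← Category.comp_id a, ← Category.comp_id b, ← hrs, ← Category.assoc, this, Category.assoc]

theorem isPullback [RegularCat C] [StablyContinuous L] (k l : SFilt L) :
    IsPullback (X.map (SFilt.inter_le_left k l)) (X.map (SFilt.inter_le_right k l))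
      (X.map (SFilt.le_join_left k l)) (X.map (SFilt.le_join_right k l)) := by
  have hP := IsPullback.of_hasPullback (X.map (SFilt.le_join_left k l))
    (X.map (SFilt.le_join_right k l))
  have hpq : (X.H k).hom ≫ X.map (SFilt.le_join_left k l) =
      (X.H l).hom ≫ X.map (SFilt.le_join_right k l) := by rw [hom_map, hom_map]
  let m := hP.lift _ _ hpq
  have hm : StrongEpi m := strongEpi_of_kerCommute (X.kercomm k l) hP hpq (fun t hk hl => by
    rw [hom_map]
    exact (X.presSup _ _ (SFilt.isLUB_join k l)).2 t (by rintro _ (rfl | rfl) <;> assumption))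
    m (hP.lift_fst _ _ _) (hP.lift_snd _ _ _)
  obtain ⟨s, hs⟩ : ∃ s : _ ⟶ (X.H (SFilt.inter k l)).cod, m ≫ s = (X.H (SFilt.inter k l)).hom :=
    (X.presInf _ (Set.toFinite _) _ (SFilt.isGLB_inter k l)).2 (.ofStrongEpi m) (by
      rintro _ (rfl | rfl)
      · exact ⟨_, hP.lift_fst _ _ _⟩
      · exact ⟨_, hP.lift_snd _ _ _⟩)
  have hw : X.map (SFilt.inter_le_left k l) ≫ X.map (SFilt.le_join_left k l) =
      X.map (SFilt.inter_le_right k l) ≫ X.map (SFilt.le_join_right k l) := by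
    rw [map_map, map_map]
  let d := hP.lift _ _ hw
  have hd : (X.H (SFilt.inter k l)).hom ≫ d = m := by
    refine hP.hom_ext ?_ ?_
    · rw [Category.assoc, hP.lift_fst, hP.lift_fst, hom_map]
    · rw [Category.assoc, hP.lift_snd, hP.lift_snd, hom_map]
  refine IsPullback.of_iso_pullback ⟨hw⟩ ⟨d, s, ?_, ?_⟩ (hP.lift_fst _ _ _) (hP.lift_snd _ _ _)
  · rw [← cancel_epi (X.H (SFilt.inter k l)).hom, ← Category.assoc, hd, hs, Category.comp_id]
  · rw [← cancel_epi m, ← Category.assoc, hs, hd, Category.comp_id]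

/-- The diagram of quotients indexed by the filters containing a given element. -/
noncomputable def diagram (x : L) : {k : SFilt L // x ∈ k.1} ⥤ C where
  obj k := (X.H k.1).cod
  map f := X.map (leOfHom f)
  map_id _ := X.map_self _
  map_comp f g := (X.map_map (leOfHom f) (leOfHom g)).symm

variable [HasLimitsOfSize.{w, w} C]

/-- The presheaf whose sections over `x` are the limit of the quotients at filters containing
`x`. -/
noncomputable def presheaf : Lᵒᵖ ⥤ C where
  obj x := limit (X.diagram x.unop)
  map {x y} f := limit.lift (X.diagram y.unop) ⟨_, fun k => limit.π (X.diagram x.unop)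
    ⟨k.1, k.1.mem_of_le k.2 (leOfHom f.unop)⟩, fun k l g => by
      rw [← limit.w (X.diagram x.unop) (homOfLE (leOfHom g) :
        (⟨k.1, k.1.mem_of_le k.2 (leOfHom f.unop)⟩ : {k : SFilt L // x.unop ∈ k.1}) ⟶
        ⟨l.1, l.1.mem_of_le l.2 (leOfHom f.unop)⟩)]
      exact Category.id_comp _⟩
  map_id x := limit.hom_ext fun k => (limit.lift_π _ _).trans (Category.id_comp _).symm
  map_comp f g := limit.hom_ext fun k => by
    refine (limit.lift_π _ _).trans (Eq.symm ?_)
    refine (Category.assoc _ _ _).trans ((congrArg _ (limit.lift_π _ k)).trans ?_)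
    exact limit.lift_π _ _

/-- The projection from sections to a quotient. -/
noncomputable def π {x : L} {k : SFilt L} (hx : x ∈ k.1) :
    X.presheaf.obj (op x) ⟶ (X.H k).cod :=
  limit.π (X.diagram x) ⟨k, hx⟩

theorem π_map {x : L} {k l : SFilt L} (hx : x ∈ k.1) (h : k ≤ l) :
    X.π hx ≫ X.map h = X.π (h hx) :=
  limit.w (X.diagram x) (homOfLE h : (⟨k, hx⟩ : {k : SFilt L // x ∈ k.1}) ⟶ ⟨l, h hx⟩)

theorem map_π {x y : L} {k : SFilt L} (h : x ≤ y) (hx : x ∈ k.1) :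
    X.presheaf.map (homOfLE h).op ≫ X.π hx = X.π (k.mem_of_le hx h) :=
  limit.lift_π _ _

variable {X} in
theorem hom_ext {x : L} {B : C} {f g : B ⟶ X.presheaf.obj (op x)}
    (h : ∀ (k : SFilt L) (hx : x ∈ k.1), f ≫ X.π hx = g ≫ X.π hx) : f = g :=
  limit.hom_ext fun k => h k.1 k.2

/-- The universal property of sections. -/
noncomputable def lift {x : L} {B : C} (c : ∀ k : SFilt L, x ∈ k.1 → (B ⟶ (X.H k).cod))
    (hc : ∀ (k l : SFilt L) (hx : x ∈ k.1) (h : k ≤ l), c k hx ≫ X.map h = c l (h hx)) :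
    B ⟶ X.presheaf.obj (op x) :=
  limit.lift (X.diagram x) ⟨B, fun k => c k.1 k.2, fun k l f =>
    (Category.id_comp _).trans (hc k.1 l.1 k.2 (leOfHom f)).symm⟩

theorem lift_π {x : L} {B : C} (c : ∀ k : SFilt L, x ∈ k.1 → (B ⟶ (X.H k).cod))
    (hc : ∀ (k l : SFilt L) (hx : x ∈ k.1) (h : k ≤ l), c k hx ≫ X.map h = c l (h hx))
    {k : SFilt L} (hx : x ∈ k.1) : X.lift c hc ≫ X.π hx = c k hx :=
  limit.lift_π _ _

theorem presheaf_mono_terminal_from [RegularCat C] :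
    Mono (terminal.from (X.presheaf.obj (op (⊥ : L)))) := by
  have := X.mono_terminal_from
  refine ⟨fun a b _ => hom_ext fun k hk => ?_⟩
  have h : SFilt.univ L ≤ k := fun x _ => k.mem_of_le hk bot_le
  have huniv : (⊥ : L) ∈ (SFilt.univ L).1 := trivial
  rw [← X.π_map huniv h, ← Category.assoc, ← Category.assoc]
  congr 1
  rw [← cancel_mono (terminal.from _)]
  exact Subsingleton.elim _ _

theorem presheaf_isLimitOn {D : Set L} (hD : D.Nonempty) (hD' : DirectedOn (· ≤ ·) D) :
    IsLimitOn X.presheaf D (sSup D) := by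
  intro B c hc
  have hsup (k : SFilt L) (hk : sSup D ∈ k.1) : ∃ d ∈ D, d ∈ k.1 :=
    k.2.2 D hD hD' _ (isLUB_sSup D) hk
  have hle {k : SFilt L} {d e : L} (hd : d ∈ D) (he : e ∈ D) (hde : d ≤ e) (hdk : d ∈ k.1) :
      c d hd ≫ X.π hdk = c e he ≫ X.π (k.mem_of_le hdk hde) := by
    rw [← hc d e hd he hde, Category.assoc, map_π]
  have hind {k : SFilt L} {d e : L} (hd : d ∈ D) (he : e ∈ D) (hdk : d ∈ k.1) (hek : e ∈ k.1) :
      c d hd ≫ X.π hdk = c e he ≫ X.π hek := by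
    obtain ⟨f, hf, hdf, hef⟩ := hD' d hd e he
    rw [hle hd hf hdf, hle he hf hef]
  choose K hK hK' using hsup
  refine ⟨X.lift (fun k hk => c _ (hK k hk) ≫ X.π (hK' k hk)) fun k l hk h => ?_, ?_, ?_⟩
  · rw [Category.assoc, π_map]
    exact hind _ _ _ _
  · intro d hd hds
    refine hom_ext fun k hk => ?_
    rw [Category.assoc, map_π, lift_π]
    exact hind _ _ _ _
  · intro u hu
    refine hom_ext fun k hk => ?_
    rw [lift_π, ← hu _ (hK k hk) (le_sSup (hK k hk)), Category.assoc, map_π]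

theorem presheaf_isPullback [RegularCat C] [StablyContinuous L] (x y : L) :
    IsPullback (X.presheaf.map (homOfLE (le_sup_left : x ≤ x ⊔ y)).op)
      (X.presheaf.map (homOfLE (le_sup_right : y ≤ x ⊔ y)).op)
      (X.presheaf.map (homOfLE (inf_le_left : x ⊓ y ≤ x)).op)
      (X.presheaf.map (homOfLE (inf_le_right : x ⊓ y ≤ y)).op) := by
  have hmem {a b : SFilt L} (ha : x ∈ a.1) (hb : y ∈ b.1) : x ⊔ y ∈ (SFilt.inter a b).1 :=
    ⟨a.mem_of_le ha le_sup_left, b.mem_of_le hb le_sup_right⟩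
  refine IsPullback.mk' ?_ ?_ ?_
  · rw [map_homOfLE_comp, map_homOfLE_comp]
  · intro T f g h h'
    refine hom_ext fun k hk => ?_
    obtain ⟨a, b, ha, hb, hab⟩ := k.exists_inter_le hk
    rw [← X.π_map (hmem ha hb) hab, ← Category.assoc, ← Category.assoc]
    congr 1
    refine (X.isPullback a b).hom_ext ?_ ?_
    · rw [Category.assoc, Category.assoc, π_map, ← X.map_π le_sup_left ha, ← Category.assoc, h,
        Category.assoc]
    · rw [Category.assoc, Category.assoc, π_map, ← X.map_π le_sup_right hb, ← Category.assoc, h',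
        Category.assoc]
  · intro T s t hst
    have hw (a b : SFilt L) (ha : x ∈ a.1) (hb : y ∈ b.1) :
        (s ≫ X.π ha) ≫ X.map (SFilt.le_join_left a b) =
          (t ≫ X.π hb) ≫ X.map (SFilt.le_join_right a b) := by
      rw [Category.assoc, Category.assoc, π_map, π_map,
        ← X.map_π inf_le_left (SFilt.inf_mem_join ha hb), ← Category.assoc, hst, Category.assoc,
        map_π]
    let W (a b : SFilt L) (ha : x ∈ a.1) (hb : y ∈ b.1) : T ⟶ (X.H (SFilt.inter a b)).cod :=
      (X.isPullback a b).lift _ _ (hw a b ha hb)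
    have hW₁ (a b : SFilt L) (ha : x ∈ a.1) (hb : y ∈ b.1) :
        W a b ha hb ≫ X.map (SFilt.inter_le_left a b) = s ≫ X.π ha :=
      (X.isPullback a b).lift_fst _ _ _
    have hW₂ (a b : SFilt L) (ha : x ∈ a.1) (hb : y ∈ b.1) :
        W a b ha hb ≫ X.map (SFilt.inter_le_right a b) = t ≫ X.π hb :=
      (X.isPullback a b).lift_snd _ _ _
    have hle {a b a' b' : SFilt L} (ha : x ∈ a.1) (hb : y ∈ b.1) (haa : a ≤ a') (hbb : b ≤ b')
        (h : SFilt.inter a b ≤ SFilt.inter a' b') :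
        W a b ha hb ≫ X.map h = W a' b' (haa ha) (hbb hb) := by
      refine (X.isPullback a' b').hom_ext ?_ ?_
      · rw [Category.assoc, map_map, hW₁, ← X.map_map (SFilt.inter_le_left a b) haa,
          ← Category.assoc, hW₁, Category.assoc, π_map]
      · rw [Category.assoc, map_map, hW₂, ← X.map_map (SFilt.inter_le_right a b) hbb,
          ← Category.assoc, hW₂, Category.assoc, π_map]
    have hind {k a b a' b' : SFilt L} (ha : x ∈ a.1) (hb : y ∈ b.1) (ha' : x ∈ a'.1)
        (hb' : y ∈ b'.1) (h : SFilt.inter a b ≤ k) (h' : SFilt.inter a' b' ≤ k) :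
        W a b ha hb ≫ X.map h = W a' b' ha' hb' ≫ X.map h' := by
      have hl : SFilt.inter (SFilt.inter a a') (SFilt.inter b b') ≤ SFilt.inter a b :=
        fun z hz => ⟨hz.1.1, hz.2.1⟩
      have hr : SFilt.inter (SFilt.inter a a') (SFilt.inter b b') ≤ SFilt.inter a' b' :=
        fun z hz => ⟨hz.1.2, hz.2.2⟩
      have haa : x ∈ (SFilt.inter a a').1 := ⟨ha, ha'⟩
      have hbb : y ∈ (SFilt.inter b b').1 := ⟨hb, hb'⟩
      rw [← hle haa hbb (SFilt.inter_le_left _ _) (SFilt.inter_le_left _ _) hl,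
        ← hle haa hbb (SFilt.inter_le_right _ _) (SFilt.inter_le_right _ _) hr,
        Category.assoc, Category.assoc, map_map, map_map]
    choose a b ha hb hab using fun (k : SFilt L) (hk : x ⊔ y ∈ k.1) => k.exists_inter_le hk
    refine ⟨X.lift (fun k hk => W _ _ (ha k hk) (hb k hk) ≫ X.map (hab k hk))
      fun k l hk h => ?_, hom_ext fun k hk => ?_, hom_ext fun k hk => ?_⟩
    · rw [Category.assoc, map_map]
      exact hind _ _ _ _ _ _
    · have hy : y ∈ (SFilt.univ L).1 := trivial
      rw [Category.assoc, map_π, lift_π, ← hW₁ k (SFilt.univ L) hk hy]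
      exact hind _ _ _ _ _ _
    · have hx : x ∈ (SFilt.univ L).1 := trivial
      rw [Category.assoc, map_π, lift_π, ← hW₂ (SFilt.univ L) k hx hk]
      exact hind _ _ _ _ _ _

theorem isOmegaSheaf_presheaf [RegularCat C] [StablyContinuous L] : IsOmegaSheaf X.presheaf :=
  ⟨X.presheaf_mono_terminal_from, X.presheaf_isPullback, fun _ => X.presheaf_isLimitOn⟩

/-- The canonical map from `A` to the sections over an element. -/
noncomputable def toSections (x : L) : A ⟶ X.presheaf.obj (op x) :=
  X.lift (fun k _ => (X.H k).hom) fun _ _ _ h => X.hom_map h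

theorem toSections_π {x : L} {k : SFilt L} (hx : x ∈ k.1) :
    X.toSections x ≫ X.π hx = (X.H k).hom :=
  X.lift_π _ _ hx

theorem toSections_map {x y : L} (h : x ≤ y) :
    X.toSections y ≫ X.presheaf.map (homOfLE h).op = X.toSections x :=
  hom_ext fun k hx => by rw [Category.assoc, map_π, toSections_π, toSections_π]

variable [StablyContinuous L]

/-- The canonical map from the quotient at `above x` to the sections over `x`. -/
noncomputable def ofAbove (x : L) : (X.H (SFilt.above x)).cod ⟶ X.presheaf.obj (op x) :=
  X.lift (fun _ hx => X.map (SFilt.above_le hx)) fun _ _ _ _ => X.map_map _ _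

theorem hom_ofAbove (x : L) : (X.H (SFilt.above x)).hom ≫ X.ofAbove x = X.toSections x :=
  hom_ext fun k hx => by rw [Category.assoc, ofAbove, lift_π, hom_map, toSections_π]

theorem π_ofAbove {x y : L} (h : y ∈ (SFilt.above x).1) :
    X.π h ≫ X.ofAbove x = X.presheaf.map (homOfLE (WayBelow.le h)).op :=
  hom_ext fun k hx => by rw [Category.assoc, ofAbove, lift_π, π_map, map_π]

theorem exists_desc_π [RegularCat C] {k : SFilt L} {Q : C}
    (legs : ∀ x ∈ k.1, X.presheaf.obj (op x) ⟶ Q)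
    (h : ∀ (x y : L) (hx : x ∈ k.1) (hy : y ∈ k.1) (h : x ≤ y),
      X.presheaf.map (homOfLE h).op ≫ legs x hx = legs y hy) :
    ∃ u : (X.H k).cod ⟶ Q, ∀ x hx, X.π hx ≫ u = legs x hx := by
  have hlegs (x : L) (hx : x ∈ k.1) :
      X.toSections x ≫ legs x hx = X.toSections ⊤ ≫ legs ⊤ k.top_mem := by
    rw [← h x ⊤ hx k.top_mem le_top, ← Category.assoc, toSections_map]
  obtain ⟨u, hu⟩ := X.exists_desc_of_isLUB k.isLUB_above (X.toSections ⊤ ≫ legs ⊤ k.top_mem) (by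
    rintro _ ⟨x, hx, rfl⟩
    exact ⟨X.ofAbove x ≫ legs x hx, by rw [← Category.assoc, hom_ofAbove, hlegs]⟩)
  refine ⟨u, fun x hx => ?_⟩
  obtain ⟨y, hy, hyx⟩ := k.exists_wayBelow hx
  have : X.map (SFilt.above_le hy) ≫ u = X.ofAbove y ≫ legs y hy := by
    rw [← cancel_epi (X.H (SFilt.above y)).hom, ← Category.assoc, hom_map, hu, ← Category.assoc,
      hom_ofAbove]
    exact (hlegs y hy).symm
  have hyx' : x ∈ (SFilt.above y).1 := hyx
  rw [← X.π_map hyx' (SFilt.above_le hy), Category.assoc, this, ← Category.assoc, X.π_ofAbove hyx',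
    h]

theorem isSoftOmega_presheaf [RegularCat C] : IsSoftOmega X.presheaf := by
  intro k' hk' Q legs hlegs huniv x hx hle
  obtain ⟨k, rfl⟩ : ∃ k : SFilt L, k.1 = k' := ⟨⟨k', hk'⟩, rfl⟩
  obtain ⟨u, hu⟩ := X.exists_desc_π legs hlegs
  obtain ⟨r, hr, -⟩ := huniv (X.H k).cod (fun x hx => X.π hx) fun x y hx hy h => X.map_π h hx
  have hur : u ≫ r = 𝟙 _ := by
    rw [← cancel_epi (X.H k).hom, ← X.toSections_π k.top_mem, Category.assoc,
      ← Category.assoc (X.π _), hu, hr, Category.comp_id]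
  have hru : r ≫ u = 𝟙 _ := by
    obtain ⟨i, -, hi⟩ := huniv Q legs hlegs
    rw [hi (r ≫ u) fun x hx => by rw [← Category.assoc, hr, hu]]
    exact (hi (𝟙 Q) fun x hx => Category.comp_id _).symm
  have : IsIso u := ⟨r, hur, hru⟩
  have : StrongEpi (X.toSections ⊤ ≫ X.π k.top_mem) := by
    rw [toSections_π]
    infer_instance
  have := strongEpi_of_strongEpi (X.toSections ⊤) (X.π k.top_mem)
  rw [hlegs x ⊤ hx k.top_mem hle, ← hu]
  have := strongEpi_comp (X.π k.top_mem) u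
  exact RegularCat.regularEpi_of_strongEpi _

theorem isIso_toSections_top [RegularCat C] : IsIso (X.toSections ⊤) := by
  obtain ⟨r, hr⟩ : ∃ r : (X.H (SFilt.single L)).cod ⟶ A, (X.H (SFilt.single L)).hom ≫ r = 𝟙 A :=
    (X.presSup ∅ _ SFilt.isLUB_single).2 (.ofStrongEpi (𝟙 A)) fun _ h => h.elim
  refine ⟨X.π (SFilt.single L).top_mem ≫ r, ?_, hom_ext fun k hk => ?_⟩
  · rw [← Category.assoc, toSections_π, hr]
  · have : r ≫ (X.H k).hom = X.map k.single_le := by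
      rw [← cancel_epi (X.H (SFilt.single L)).hom, ← Category.assoc, hr, Category.id_comp, hom_map]
    rw [Category.assoc, Category.assoc, toSections_π, this, π_map, Category.id_comp]

/-- The soft sheaf representation associated with a map of preorders. -/
noncomputable def toSoftOmShrRep [RegularCat C] : SoftOmShrRep C (L := L) A where
  F := X.presheaf
  osheaf := X.isOmegaSheaf_presheaf
  soft := X.isSoftOmega_presheaf
  φ := X.toSections ⊤
  iso := X.isIso_toSections_top

theorem quot_toSoftOmShrRep_le [RegularCat C] [HasColimitsOfSize.{w, w} C] (k : SFilt L) :
    (X.toSoftOmShrRep.quot k).le (X.H k) := by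
  refine ⟨stalk.desc (F := X.presheaf) (fun x hx => X.π hx) fun x y hx hy h => X.map_π h hx, ?_⟩
  change (X.toSections ⊤ ≫ stalk.ι X.presheaf k k.top_mem) ≫ _ = _
  rw [Category.assoc, stalk.ι_desc, toSections_π]

theorem le_quot_toSoftOmShrRep [RegularCat C] [HasColimitsOfSize.{w, w} C] (k : SFilt L) :
    (X.H k).le (X.toSoftOmShrRep.quot k) := by
  obtain ⟨u, hu⟩ := X.exists_desc_π (fun x hx => stalk.ι X.presheaf k hx)
    fun x y hx hy h => stalk.map_ι h hx hy
  have h : (X.H k).hom ≫ u = X.toSections ⊤ ≫ stalk.ι X.presheaf k k.top_mem := by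
    rw [← X.toSections_π k.top_mem, Category.assoc, hu]
  exact ⟨u, h⟩

end Msig

namespace stalk

variable {L : Type w} [CompleteLattice L] [StablyContinuous L] [HasColimitsOfSize.{w, w} C]
  {F : Lᵒᵖ ⥤ C}

variable (F) in
/-- The canonical map from the stalk at `above x` to the sections over `x`. -/
noncomputable def ofAbove (x : L) : stalk F (SFilt.above x) ⟶ F.obj (op x) :=
  desc (fun _ hy => F.map (homOfLE (WayBelow.le hy)).op) fun _ _ _ _ _ => map_homOfLE_comp _ _ _

theorem ι_ofAbove {x y : L} (h : y ∈ (SFilt.above x).1) :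
    ι F (SFilt.above x) h ≫ ofAbove F x = F.map (homOfLE (WayBelow.le h)).op :=
  ι_desc _ _ _

theorem map_ofAbove {x y : L} (h : x ≤ y) :
    map (𝟙 F) (SFilt.above_anti h) ≫ ofAbove F x = ofAbove F y ≫ F.map (homOfLE h).op :=
  hom_ext fun z hz => by
    rw [← Category.assoc, ι_map_id, ι_ofAbove, ← Category.assoc, ι_ofAbove, map_homOfLE_comp]

theorem ofAbove_ι {k : SFilt L} {x : L} (hx : x ∈ k.1) :
    ofAbove F x ≫ ι F k hx = map (𝟙 F) (SFilt.above_le hx) :=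
  hom_ext fun z hz => by
    rw [← Category.assoc, ι_ofAbove, ι_map_id, map_ι]

theorem isLimitOn_wb
    (hF : ∀ D : Set L, D.Nonempty → DirectedOn (· ≤ ·) D → IsLimitOn F D (sSup D))
    (x : L) : IsLimitOn F (wb x) x := by
  have h := hF (wb x) (StablyContinuous.wb_nonempty x) (StablyContinuous.wb_directed x)
  rwa [(StablyContinuous.wb_isLUB x).sSup_eq] at h

/-- Sections of a sheaf are determined by their germs. -/
theorem sections_hom_ext
    (hF : ∀ D : Set L, D.Nonempty → DirectedOn (· ≤ ·) D → IsLimitOn F D (sSup D))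
    {x : L} {B : C} {f g : B ⟶ F.obj (op x)}
    (h : ∀ (k : SFilt L) (hx : x ∈ k.1), f ≫ ι F k hx = g ≫ ι F k hx) : f = g := by
  obtain ⟨u, -, hu⟩ := isLimitOn_wb hF x B (fun d hd => f ≫ F.map (homOfLE (WayBelow.le hd)).op)
    fun d e hd he hde => by rw [Category.assoc, map_homOfLE_comp]
  rw [hu f fun d hd hdx => rfl, hu g fun d hd hdx => ?_]
  have hd' : x ∈ (SFilt.above d).1 := hd
  rw [← ι_ofAbove hd', ← Category.assoc, ← Category.assoc, h]

/-- A compatible family of maps to the stalks of a sheaf lifts to its sections. -/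
theorem exists_sections_lift
    (hF : ∀ D : Set L, D.Nonempty → DirectedOn (· ≤ ·) D → IsLimitOn F D (sSup D))
    {x : L} {B : C} (c : ∀ k : SFilt L, x ∈ k.1 → (B ⟶ stalk F k))
    (hc : ∀ (k l : SFilt L) (hx : x ∈ k.1) (h : k ≤ l), c k hx ≫ map (𝟙 F) h = c l (h hx)) :
    ∃ u : B ⟶ F.obj (op x), ∀ (k : SFilt L) (hx : x ∈ k.1), u ≫ ι F k hx = c k hx := by
  obtain ⟨u, hu, -⟩ := isLimitOn_wb hF x B (fun d hd => c (SFilt.above d) hd ≫ ofAbove F d)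
    fun d e hd he hde => by
      rw [Category.assoc, ← map_ofAbove hde, ← Category.assoc]
      exact congrArg (· ≫ ofAbove F d) (hc (SFilt.above e) _ he (SFilt.above_anti hde))
  refine ⟨u, fun k hx => ?_⟩
  obtain ⟨d, hdk, hdx⟩ := k.exists_wayBelow hx
  rw [← map_ι hdx.le hdk hx, ← Category.assoc, hu d hdx, Category.assoc, ofAbove_ι hdk]
  exact hc (SFilt.above d) k hdx (SFilt.above_le hdk)

end stalk

namespace SoftOmShrRep

variable {L : Type w} [CompleteLattice L] [StablyContinuous L] [HasColimitsOfSize.{w, w} C] {A : C}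

theorem hom_subsingleton {R S : SoftOmShrRep C (L := L) A} (α β : R ⟶ S) : α = β := by
  refine Subtype.ext (NatTrans.ext (funext fun x => ?_))
  refine stalk.sections_hom_ext S.osheaf.2.2 fun k hx => ?_
  have : stalk.map α.1 (le_refl k) = stalk.map β.1 (le_refl k) := by
    rw [← cancel_epi (R.germ k), germ_map, germ_map]
  have h := congrArg (stalk.ι R.F k hx ≫ ·) this
  simp only [stalk.ι_map] at h
  exact h

theorem nonempty_hom [RegularCat C] {R S : SoftOmShrRep C (L := L) A}
    (h : ∀ k, (R.quot k).le (S.quot k)) : Nonempty (R ⟶ S) := by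
  replace h : ∀ k, ∃ d : stalk R.F k ⟶ stalk S.F k, R.germ k ≫ d = S.germ k := h
  choose d hd using h
  have hdmap {k l : SFilt L} (h : k ≤ l) :
      d k ≫ stalk.map (𝟙 S.F) h = stalk.map (𝟙 R.F) h ≫ d l := by
    rw [← cancel_epi (R.germ k), ← Category.assoc, hd, germ_map_id, ← Category.assoc,
      germ_map_id, hd]
  choose α hα using fun x : L => stalk.exists_sections_lift S.osheaf.2.2 (x := x)
    (fun k hx => stalk.ι R.F k hx ≫ d k) fun k l hx h => by
      rw [Category.assoc, hdmap, ← Category.assoc, stalk.ι_map_id]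
  refine ⟨⟨⟨fun x => α x.unop, fun x y f => ?_⟩, ?_⟩⟩
  · refine stalk.sections_hom_ext S.osheaf.2.2 fun k hy => ?_
    have hyx : y.unop ≤ x.unop := leOfHom f.unop
    have hx := k.mem_of_le hy hyx
    have hR : R.F.map f ≫ stalk.ι R.F k hy = stalk.ι R.F k hx := stalk.map_ι hyx hy hx
    have hS : S.F.map f ≫ stalk.ι S.F k hy = stalk.ι S.F k hx := stalk.map_ι hyx hy hx
    rw [Category.assoc, Category.assoc, hα, hS]
    exact ((Category.assoc _ _ _).symm.trans (congrArg (· ≫ d k) hR)).trans (hα _ k hx).symm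
  · refine stalk.sections_hom_ext S.osheaf.2.2 fun k hk => ?_
    rw [Category.assoc]
    exact (congrArg (R.φ ≫ ·) (hα _ k hk)).trans ((Category.assoc _ _ _).symm.trans (hd k))

variable [RegularCat C] [HasLimitsOfSize.{w, w} C]
  (hcomm : ∀ (J : Type w) [PartialOrder J] [Nonempty J] [IsDirected J (· ≤ ·)],
    PreservesFiniteLimits (colim (J := J) (C := C)))

instance : (toMsigFunctor (L := L) A hcomm).IsEquivalence where
  faithful := ⟨fun _ => hom_subsingleton _ _⟩
  full := ⟨fun f => (nonempty_hom f.down).elim fun α => ⟨α, rfl⟩⟩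
  essSurj := ⟨fun X => ⟨X.toSoftOmShrRep,
    ⟨⟨⟨X.quot_toSoftOmShrRep_le⟩, ⟨X.le_quot_toSoftOmShrRep⟩, rfl, rfl⟩⟩⟩⟩

end SoftOmShrRep

theorem statement18 {L : Type w} [CompleteLattice L]
    -- L is a stably continuous lattice
    (hcont : ∀ x : L, (wb x).Nonempty ∧ DirectedOn (· ≤ ·) (wb x) ∧ IsLUB (wb x) x)
    (hstab : WayBelow (⊤ : L) (⊤ : L) ∧
      ∀ x y z : L, WayBelow x y → WayBelow x z → WayBelow x (y ⊓ z))
    -- C is a bicomplete regular category in which directed colimits commute with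
    -- finite limits
    [RegularCat C] [HasLimitsOfSize.{w, w} C] [HasColimitsOfSize.{w, w} C]
    (hcomm : ∀ (J : Type w) [PartialOrder J] [Nonempty J] [IsDirected J (· ≤ ·)],
      PreservesFiniteLimits (colim (J := J) (C := C)))
    (A : C) :
    Nonempty (Msig C L A ≌ SoftOmShrRep C (L := L) A) := by
  have : StablyContinuous L :=
    ⟨fun x => (hcont x).1, fun x => (hcont x).2.1, fun x => (hcont x).2.2, hstab.1, hstab.2⟩
  exact ⟨(SoftOmShrRep.toMsigFunctor A hcomm).asEquivalence.symm⟩
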